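/- A matroid representable over GF(3) and over GF(5) is representable over the rationals Q. -/

import Mathlib

/-- A matroid is representable over a field `F` if there is an assignment of
vectors to the elements such that independence in `M` coincides with linear
independence (for subsets of the ground set). -/
def Matroid.Representable' {α : Type*} (F : Type*) [Field F] (M : Matroid α) : Prop :=
  ∃ φ : α → (α → F), ∀ X : Set α, X ⊆ M.E →
    (M.Indep X ↔ LinearIndependent F (fun x : X => φ (x : α)))

instance : Fact (Nat.Prime 3) := ⟨by norm_num⟩
instance : Fact (Nat.Prime 5) := ⟨by norm_num⟩

namespace Dyad

abbrev K := ZMod 3 × ZMod 5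

def tau : Kˣ := ⟨(2, 2), (2, 3), by decide, by decide⟩

/-- `q` is a dyadic unit (or zero) reducing to `z`. -/
def Lift (q : ℚ) (z : K) : Prop :=
  (q = 0 ∧ z = 0) ∨ ∃ (s : ℤˣ) (k : ℤ), q = ((s : ℤ) : ℚ) * 2 ^ k ∧
    z = ((s : ℤ) : K) * ((tau ^ k : Kˣ) : K)

def U (z : K) : Prop := z.1 = 0 ↔ z.2 = 0

instance (z : K) : Decidable (U z) := by unfold U; infer_instance

def F1 (p : ℚ) : Prop := p = 1 ∨ p = 2 ∨ p = 1 / 2 ∨ p = -1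

theorem lift_zero : Lift 0 0 := Or.inl ⟨rfl, rfl⟩
theorem lift_one : Lift 1 1 := Or.inr ⟨1, 0, by simp, by simp⟩

theorem unit_ne (s : ℤˣ) : ((s : ℤ) : ℚ) ≠ 0 := by
  rcases Int.units_eq_one_or s with rfl | rfl <;> simp

theorem unitK (s : ℤˣ) : ((s : ℤ) : K) * ((s : ℤ) : K) = 1 := by
  rcases Int.units_eq_one_or s with rfl | rfl <;> simp

theorem lift_zero_iff {q z} (h : Lift q z) : q = 0 ↔ z = 0 := by
  rcases h with ⟨h1, h2⟩ | ⟨s, k, rfl, rfl⟩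
  · simp [h1, h2]
  · constructor
    · intro h
      exfalso
      have : (2 : ℚ) ^ k ≠ 0 := by positivity
      exact (mul_ne_zero (unit_ne s) this) h
    · intro h
      exfalso
      have h2 := congrArg (fun t => ((s : ℤ) : K) * t * ((tau ^ (-k) : Kˣ) : K)) h
      simp only [← mul_assoc, unitK, mul_zero, zero_mul, one_mul] at h2
      rw [← Units.val_mul, ← zpow_add] at h2
      simp at h2

theorem lift_mul {q z q' z'} (h : Lift q z) (h' : Lift q' z') : Lift (q * q') (z * z') := by
  rcases h with ⟨h1, h2⟩ | ⟨s, k, rfl, rfl⟩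
  · left; simp [h1, h2]
  rcases h' with ⟨h1, h2⟩ | ⟨s', k', rfl, rfl⟩
  · left; simp [h1, h2]
  right
  refine ⟨s * s', k + k', ?_, ?_⟩
  · rw [zpow_add₀ (by norm_num)]; push_cast; ring
  · rw [zpow_add]; push_cast; ring

theorem lift_neg {q z} (h : Lift q z) : Lift (-q) (-z) := by
  have : Lift (-1) (-1) := Or.inr ⟨-1, 0, by simp, by simp⟩
  simpa using lift_mul this h

theorem lift_inv {q z} (h : Lift q z) : Lift (q⁻¹) (z⁻¹) := by
  rcases h with ⟨h1, h2⟩ | ⟨s, k, rfl, rfl⟩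
  · left; rw [h1, h2]; exact ⟨by simp, Prod.ext (by simp) (by simp)⟩
  right
  refine ⟨s, -k, ?_, ?_⟩
  · rw [mul_inv, zpow_neg]
    rcases Int.units_eq_one_or s with rfl | rfl <;> simp
  · rw [mul_inv, zpow_neg, Units.val_inv_eq_inv_val]
    rcases Int.units_eq_one_or s with rfl | rfl
    · simp
    · congr 1
      exact Prod.ext (by simp [inv_neg]) (by simp [inv_neg])

theorem U_mul_inv {z : K} (h : U z) (h0 : z ≠ 0) : z * z⁻¹ = 1 := by
  have h1 : z.1 ≠ 0 := fun h' => h0 (Prod.ext h' (h.1 h'))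
  have h2 : z.2 ≠ 0 := fun h' => h0 (Prod.ext (h.2 h') h')
  exact Prod.ext (mul_inv_cancel₀ h1) (mul_inv_cancel₀ h2)

theorem lift_U {q z} (h : Lift q z) : U z := by
  rcases h with ⟨h1, h2⟩ | ⟨s, k, rfl, rfl⟩
  · subst h2; decide
  · have : IsUnit (((s : ℤ) : K) * ((tau ^ k : Kˣ) : K)) :=
      (IsUnit.of_mul_eq_one _ (unitK s)).mul (Units.isUnit _)
    rw [Prod.isUnit_iff] at this
    unfold U
    constructor
    · intro h; exact absurd h this.1.ne_zero
    · intro h; exact absurd h this.2.ne_zero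

theorem lift_ex {z : K} (h : U z) : ∃ q, Lift q z := by
  have key : ∀ z : K, U z → z = 0 ∨ z = 1 ∨ z = -1 ∨ z = (2,2) ∨ z = -(2,2) ∨
    z = (2,2) * (2,2) ∨ z = - ((2,2) * (2,2)) ∨ z = (2,3) ∨ z = -(2,3) := by decide
  have l2 : Lift 2 (2,2) := Or.inr ⟨1, 1, by simp, by simp [tau]⟩
  have l3 : Lift (2⁻¹) (2,3) := Or.inr ⟨1, -1, by simp, by simp [tau]⟩
  rcases key z h with rfl | rfl | rfl | rfl | rfl | rfl | rfl | rfl | rfl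
  · exact ⟨_, lift_zero⟩
  · exact ⟨_, lift_one⟩
  · exact ⟨_, lift_neg lift_one⟩
  · exact ⟨_, l2⟩
  · exact ⟨_, lift_neg l2⟩
  · exact ⟨_, lift_mul l2 l2⟩
  · exact ⟨_, lift_neg (lift_mul l2 l2)⟩
  · exact ⟨_, l3⟩
  · exact ⟨_, lift_neg l3⟩

theorem zp_inj {k m : ℤ} (h : (2 : ℚ) ^ k = 2 ^ m) : k = m :=
  zpow_right_injective₀ (by norm_num) (by norm_num) h

theorem lift_fun {q z z'} (h : Lift q z) (h' : Lift q z') : z = z' := by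
  by_cases hq : q = 0
  · rw [(lift_zero_iff h).1 hq, (lift_zero_iff h').1 hq]
  rcases h with ⟨h1, h2⟩ | ⟨s, k, rfl, rfl⟩
  · exact absurd h1 hq
  rcases h' with ⟨h1, h2⟩ | ⟨s', k', h1, rfl⟩
  · exact absurd h1 hq
  have p1 : (0 : ℚ) < 2 ^ k := by positivity
  have p2 : (0 : ℚ) < 2 ^ k' := by positivity
  rcases Int.units_eq_one_or s with rfl | rfl <;> rcases Int.units_eq_one_or s' with rfl | rfl <;>
    simp at h1
  · rw [h1]
  · linarith
  · linarith
  · rw [h1]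

theorem lift_two : Lift 2 (2,2) := Or.inr ⟨1, 1, by simp, by simp [tau]⟩
theorem lift_half : Lift (1/2) (2,3) := Or.inr ⟨1, -1, by simp, by simp [tau]⟩

theorem F1_z {p z} (h : F1 p) (hl : Lift p z) : (p = 1 ∧ z = 1) ∨ (p = 2 ∧ z = (2,2)) ∨
    (p = 1/2 ∧ z = (2,3)) ∨ (p = -1 ∧ z = -1) := by
  rcases h with rfl | rfl | rfl | rfl
  · exact Or.inl ⟨rfl, lift_fun hl lift_one⟩
  · exact Or.inr (Or.inl ⟨rfl, lift_fun hl lift_two⟩)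
  · exact Or.inr (Or.inr (Or.inl ⟨rfl, lift_fun hl lift_half⟩))
  · exact Or.inr (Or.inr (Or.inr ⟨rfl, lift_fun hl (lift_neg lift_one)⟩))

/-- one plus minus powers of two -/
theorem two_pow_aux (k m : ℤ) (e e' : ℚ) (he : e = 1 ∨ e = -1) (he' : e' = 1 ∨ e' = -1)
    (hkm : k < m) (h : e * 2 ^ k + e' * 2 ^ m = 1) : e * 2 ^ k = -1 := by
  obtain ⟨n, rfl⟩ : ∃ n : ℕ, m = k + (n + 1 : ℕ) := ⟨(m - k - 1).toNat, by omega⟩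
  rw [zpow_add₀ (by norm_num), zpow_natCast] at h
  have h1 : (2 : ℚ) ^ (-k) = e + e' * 2 ^ (n + 1) := by
    rw [zpow_neg, inv_eq_one_div, ← h]
    have : (2 : ℚ) ^ k ≠ 0 := by positivity
    field_simp
  have hk : k = 0 := by
    have hodd : ∃ c : ℤ, (2 : ℚ) ^ (-k) = 2 * c + 1 := by
      rw [h1]
      rcases he with rfl | rfl <;> rcases he' with rfl | rfl
      · exact ⟨2 ^ n, by push_cast; ring⟩
      · exact ⟨-2 ^ n, by push_cast; ring⟩
      · exact ⟨2 ^ n - 1, by push_cast; ring⟩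
      · exact ⟨-2 ^ n - 1, by push_cast; ring⟩
    obtain ⟨c, hc⟩ := hodd
    by_contra hne
    rcases lt_or_gt_of_ne hne with hlt | hgt
    · obtain ⟨j, hj⟩ : ∃ j : ℕ, -k = (j + 1 : ℕ) := ⟨(-k - 1).toNat, by omega⟩
      rw [hj, zpow_natCast] at hc
      have : (2 : ℤ) ^ (j + 1) = 2 * c + 1 := by exact_mod_cast hc
      rw [pow_succ] at this
      omega
    · obtain ⟨j, hj⟩ : ∃ j : ℕ, k = (j + 1 : ℕ) := ⟨(k - 1).toNat, by omega⟩
      rw [hj, zpow_neg, zpow_natCast] at hc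
      have h2 : (1 : ℚ) = (2 * c + 1) * 2 ^ (j + 1) := by
        rw [← hc]; field_simp
      have : (1 : ℤ) = (2 * c + 1) * 2 ^ (j + 1) := by exact_mod_cast h2
      have h3 : (1 : ℤ) = 2 * ((2 * c + 1) * 2 ^ j) := by
        rw [pow_succ] at this; linarith
      omega
  subst hk
  simp only [zpow_zero, mul_one, one_mul] at h ⊢
  rcases he with rfl | rfl
  · exfalso
    have : (2 : ℚ) ^ (n + 1) ≠ 0 := by positivity
    rcases he' with rfl | rfl <;> · apply this; linarith
  · rfl

theorem unit_cases (s : ℤˣ) : ((s : ℤ) : ℚ) = 1 ∨ ((s : ℤ) : ℚ) = -1 := by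
  rcases Int.units_eq_one_or s with rfl | rfl <;> simp

theorem F1_of_lift {p z w} (hp : Lift p z) (h0 : p ≠ 0) (h : Lift (1 - p) w) : F1 p := by
  rcases hp with ⟨h1, h2⟩ | ⟨s, k, hs, -⟩
  · exact absurd h1 h0
  rcases h with ⟨h1, h2⟩ | ⟨s', m, hs', -⟩
  · left; linarith
  have hsum : ((s : ℤ) : ℚ) * 2 ^ k + ((s' : ℤ) : ℚ) * 2 ^ m = 1 := by rw [← hs, ← hs']; ring
  rcases lt_trichotomy k m with hlt | heq | hgt
  · have := two_pow_aux k m _ _ (unit_cases s) (unit_cases s') hlt hsum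
    right; right; right; rw [hs, this]
  · subst heq
    right; right; left
    have p1 : (0 : ℚ) < 2 ^ k := by positivity
    rcases unit_cases s with e | e <;> rcases unit_cases s' with e' | e' <;>
      rw [e] at hs hsum <;> rw [e'] at hsum <;> linarith
  · have := two_pow_aux m k _ _ (unit_cases s') (unit_cases s) hgt (by linarith)
    right; left; linarith

theorem lift_of_F1 {p z} (h : F1 p) (hl : Lift p z) : Lift (1 - p) (1 - z) := by
  rcases F1_z h hl with ⟨rfl, rfl⟩ | ⟨rfl, rfl⟩ | ⟨rfl, rfl⟩ | ⟨rfl, rfl⟩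
  · simpa using lift_zero
  · have := lift_neg lift_one
    convert this using 1
    norm_num
    decide
  · convert lift_half using 1
    norm_num
    decide
  · convert lift_two using 1
    norm_num
    decide

theorem F1_inj {p p' z} (h : F1 p) (h' : F1 p') (hl : Lift p z) (hl' : Lift p' z) : p = p' := by
  rcases F1_z h hl with ⟨rfl, rfl⟩ | ⟨rfl, rfl⟩ | ⟨rfl, rfl⟩ | ⟨rfl, rfl⟩ <;>
  rcases F1_z h' hl' with ⟨rfl, h2⟩ | ⟨rfl, h2⟩ | ⟨rfl, h2⟩ | ⟨rfl, h2⟩ <;>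
  first | rfl | (exfalso; revert h2; decide)

theorem F1_mul {p p' z z'} (h : F1 p) (h' : F1 p') (hl : Lift p z) (hl' : Lift p' z')
    (hu : U (1 - z * z')) : F1 (p * p') := by
  rcases F1_z h hl with ⟨rfl, rfl⟩ | ⟨rfl, rfl⟩ | ⟨rfl, rfl⟩ | ⟨rfl, rfl⟩ <;>
  rcases F1_z h' hl' with ⟨rfl, rfl⟩ | ⟨rfl, rfl⟩ | ⟨rfl, rfl⟩ | ⟨rfl, rfl⟩ <;>
  first | (exfalso; revert hu; decide) | (unfold F1; norm_num)

theorem F1_neg {p z} (h : F1 p) (hl : Lift p z) (hu : U (1 + z)) : F1 (-p) := by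
  rcases F1_z h hl with ⟨rfl, rfl⟩ | ⟨rfl, rfl⟩ | ⟨rfl, rfl⟩ | ⟨rfl, rfl⟩ <;>
  first | (exfalso; revert hu; decide) | (unfold F1; norm_num)

theorem F1_inv {p} (h : F1 p) : F1 (p⁻¹) := by
  rcases h with rfl | rfl | rfl | rfl <;> (unfold F1; norm_num)

theorem F1_ex {z : K} (h0 : z ≠ 0) (h : U z) (h1 : U (1 - z)) : ∃ p, F1 p ∧ Lift p z := by
  have key : ∀ z : K, z ≠ 0 → U z → U (1 - z) → z = 1 ∨ z = (2,2) ∨ z = (2,3) ∨ z = -1 := by decide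
  rcases key z h0 h h1 with rfl | rfl | rfl | rfl
  · exact ⟨1, by simp [F1], lift_one⟩
  · exact ⟨2, by simp [F1], lift_two⟩
  · exact ⟨1/2, by simp [F1], lift_half⟩
  · exact ⟨-1, by simp [F1], lift_neg lift_one⟩

end Dyad

open Matrix
namespace Dyad

/-- inverses are well behaved -/
class InvOK (F : Type*) [CommRing F] [Inv F] : Prop where
  ok : ∀ a b : F, a * b = 1 → a⁻¹ = b

instance {F : Type*} [Field F] : InvOK F := ⟨fun _ _ h => (eq_inv_of_mul_eq_one_right h).symm⟩

instance : InvOK K := ⟨fun a b h => Prod.ext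
  (InvOK.ok a.1 b.1 (congrArg Prod.fst h)) (InvOK.ok a.2 b.2 (congrArg Prod.snd h))⟩

theorem inv_neg_inv {F : Type*} [CommRing F] [Inv F] [InvOK F] {a : F} (h : a * a⁻¹ = 1) :
    (-a⁻¹) * (-a⁻¹)⁻¹ = 1 := by
  rw [InvOK.ok (-a⁻¹) (-a) (by linear_combination h)]
  linear_combination h

open Classical in
/-- symmetric pivot -/
noncomputable def piv {X Y F : Type*} [CommRing F] [Inv F] (A : Matrix X Y F) (x : X) (y : Y) :
    Matrix X Y F := Matrix.of fun x' y' =>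
  if x' = x then (if y' = y then -(A x y)⁻¹ else A x y' * (A x y)⁻¹)
  else if y' = y then A x' y * (A x y)⁻¹ else A x' y' - A x' y * A x y' * (A x y)⁻¹

section
variable {X Y F : Type*} [CommRing F] [Inv F] (A : Matrix X Y F) (x : X) (y : Y)

theorem piv_xy : piv A x y x y = -(A x y)⁻¹ := by simp [piv]
theorem piv_x {y'} (h : y' ≠ y) : piv A x y x y' = A x y' * (A x y)⁻¹ := by simp [piv, h]
theorem piv_y {x'} (h : x' ≠ x) : piv A x y x' y = A x' y * (A x y)⁻¹ := by simp [piv, h]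
theorem piv_o {x' y'} (h : x' ≠ x) (h' : y' ≠ y) :
    piv A x y x' y' = A x' y' - A x' y * A x y' * (A x y)⁻¹ := by simp [piv, h, h']

theorem piv_transpose : piv Aᵀ y x = (piv A x y)ᵀ := by
  ext y' x'
  by_cases h : x' = x <;> by_cases h' : y' = y <;> simp [piv, h, h', Matrix.transpose_apply]
  ring

theorem minor_cons {n : ℕ} (r : Fin n → X) (c : Fin n → Y) (h : A x y * (A x y)⁻¹ = 1) :
    (A.submatrix (Fin.cons x r : Fin (n+1) → X) (Fin.cons y c : Fin (n+1) → Y)).det =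
      A x y * Matrix.det (Matrix.of fun i j : Fin n =>
        A (r i) (c j) - A (r i) y * A x (c j) * (A x y)⁻¹) := by
  set c' : Fin (n+1) → Y := Fin.cons y c with hc'
  rw [Matrix.det_eq_of_forall_row_eq_smul_add_const
    (B := Matrix.of fun i j => (Fin.cons (A x (c' j)) (fun i' => A (r i') (c' j) -
        A (r i') y * A x (c' j) * (A x y)⁻¹) : Fin (n+1) → F) i)
    (c := (Fin.cons 0 (fun i' => A (r i') y * (A x y)⁻¹) : Fin (n+1) → F)) (k := 0)]
  · rw [Matrix.det_succ_column_zero, Fin.sum_univ_succ]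
    rw [Finset.sum_eq_zero]
    · simp [Matrix.submatrix, hc']
    · intro i _
      have : A (r i) y - A (r i) y * A x y * (A x y)⁻¹ = 0 := by
        rw [mul_assoc, h]; ring
      simp [hc', this]
  · rfl
  · intro i j
    refine Fin.cases ?_ (fun i' => ?_) i
    · simp
    · simp; ring

/-- case both x, y not used -/
theorem minor_a {n : ℕ} (r : Fin n → X) (c : Fin n → Y) (h : A x y * (A x y)⁻¹ = 1)
    (hr : ∀ i, r i ≠ x) (hc : ∀ i, c i ≠ y) :
    ((piv A x y).submatrix r c).det = (A x y)⁻¹ *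
    (A.submatrix (Fin.cons x r : Fin (n+1) → X) (Fin.cons y c : Fin (n+1) → Y)).det := by
  rw [minor_cons A x y r c h, ← mul_assoc, mul_comm (A x y)⁻¹, h, one_mul]
  congr 1
  ext i j
  simp [piv_o A x y (hr i) (hc j)]

theorem minor_b {n : ℕ} (r : Fin n → X) (c : Fin n → Y) (h : A x y * (A x y)⁻¹ = 1) (i0 : Fin n)
    (hr : r i0 = x) (hi : Function.Injective r) (hc : ∀ i, c i ≠ y) :
    ((piv A x y).submatrix r c).det = (A x y)⁻¹ * (A.submatrix r c).det := by
  have h1 : (A.submatrix r c).det =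
      (((piv A x y).submatrix r c).updateRow i0 ((A x y) • ((piv A x y).submatrix r c) i0)).det := by
    refine Matrix.det_eq_of_forall_row_eq_smul_add_const
      (fun i => if i = i0 then 0 else A (r i) y * (A x y)⁻¹) i0 (by simp) ?_
    intro i j
    by_cases hij : i = i0
    · subst hij
      simp [hr, piv_x A x y (hc j)]
      linear_combination (-A x (c j)) * h
    · have : r i ≠ x := fun h => hij (hi (h.trans hr.symm))
      simp [hij, hr, piv_x A x y (hc j), piv_o A x y this (hc j)]
      linear_combination (-A x (c j) * A (r i) y * (A x y)⁻¹) * h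
  rw [h1, Matrix.det_updateRow_smul, Matrix.updateRow_eq_self]
  linear_combination (- ((piv A x y).submatrix r c).det) * h

theorem minor_c {n : ℕ} (r : Fin n → X) (c : Fin n → Y) (h : A x y * (A x y)⁻¹ = 1)
    (hr : ∀ i, r i ≠ x) (hc : ∀ i, c i ≠ y)
    [InvOK F] :
    ((piv A x y).submatrix (Fin.cons x r : Fin (n+1) → X) (Fin.cons y c : Fin (n+1) → Y)).det =
      - (A x y)⁻¹ * (A.submatrix r c).det := by
  have hinv := inv_neg_inv h
  rw [minor_cons, piv_xy]
  · congr 2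
    ext i j
    simp only [of_apply, submatrix_apply]
    rw [piv_o A x y (hr i) (hc j), piv_y A x y (hr i), piv_x A x y (hc j)]
    have h2 : (-(A x y)⁻¹)⁻¹ = - A x y := by
      linear_combination (A x y) * (- hinv) + (-(-(A x y)⁻¹)⁻¹) * h
    rw [h2]
    linear_combination (A (r i) y * A x (c j) * (A x y)⁻¹) * h
  · rw [piv_xy]; exact hinv

end

theorem fin_perm {n : ℕ} {Z : Type*} (r : Fin (n+1) → Z) (i : Fin (n+1)) :
    ∃ (σ : Equiv.Perm (Fin (n+1))) (r' : Fin n → Z), r = (Fin.cons (r i) r' : Fin (n+1) → Z) ∘ σ := by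
  refine ⟨Equiv.swap 0 i, Fin.tail (r ∘ Equiv.swap 0 i), ?_⟩
  have : (Fin.cons (r i) (Fin.tail (r ∘ Equiv.swap 0 i)) : Fin (n+1) → Z) = r ∘ Equiv.swap 0 i := by
    have := Fin.cons_self_tail (r ∘ Equiv.swap 0 i)
    simpa using this
  rw [this]
  ext j
  simp

/-- every minor of a pivot is zero or plus minus a minor divided by the pivot. -/
theorem piv_minor {X Y : Type*} {n : ℕ} (r : Fin n → X) (c : Fin n → Y) (x : X) (y : Y) :
    ∃ (n' : ℕ) (r' : Fin n' → X) (c' : Fin n' → Y) (s : ℤ), (s = 0 ∨ s = 1 ∨ s = -1) ∧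
    (∀ i, c' i = y ∨ ∃ j, c' i = c j) ∧
    ∀ (F : Type) [CommRing F] [Inv F] [InvOK F] (A : Matrix X Y F), A x y * (A x y)⁻¹ = 1 →
      ((piv A x y).submatrix r c).det = (s : F) * (A x y)⁻¹ * (A.submatrix r' c').det := by
  by_cases hri : Function.Injective r
  swap
  · refine ⟨n, r, c, 0, Or.inl rfl, fun i => Or.inr ⟨i, rfl⟩, fun F _ _ _ A h => ?_⟩
    simp only [Function.Injective, not_forall] at hri
    obtain ⟨i, j, hij, hne⟩ := hri
    rw [Matrix.det_zero_of_row_eq hne]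
    · simp
    · ext k; simp [hij]
  by_cases hci : Function.Injective c
  swap
  · refine ⟨n, r, c, 0, Or.inl rfl, fun i => Or.inr ⟨i, rfl⟩, fun F _ _ _ A h => ?_⟩
    simp only [Function.Injective, not_forall] at hci
    obtain ⟨i, j, hij, hne⟩ := hci
    rw [Matrix.det_zero_of_column_eq hne]
    · simp
    · intro k; simp [hij]
  by_cases hr : ∀ i, r i ≠ x
  · by_cases hc : ∀ i, c i ≠ y
    · refine ⟨n+1, Fin.cons x r, Fin.cons y c, 1, by simp, ?_, fun F _ _ _ A h => ?_⟩
      · intro i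
        refine Fin.cases (by simp) (fun i => Or.inr ⟨i, by simp⟩) i
      · rw [minor_a A x y r c h hr hc]; simp
    · push Not at hc
      obtain ⟨j, hj⟩ := hc
      refine ⟨n, r, c, 1, by simp, fun i => Or.inr ⟨i, rfl⟩, fun F _ _ _ A h => ?_⟩
      have := minor_b Aᵀ y x c r h j hj hci hr
      rw [piv_transpose, ← Matrix.transpose_submatrix, ← Matrix.transpose_submatrix,
        Matrix.det_transpose, Matrix.det_transpose] at this
      simpa using this
  · push Not at hr
    obtain ⟨i, hi⟩ := hr
    by_cases hc : ∀ i, c i ≠ y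
    · refine ⟨n, r, c, 1, by simp, fun i => Or.inr ⟨i, rfl⟩, fun F _ _ _ A h => ?_⟩
      simpa using minor_b A x y r c h i hi hri hc
    · push Not at hc
      obtain ⟨j, hj⟩ := hc
      obtain _ | n := n
      · exact i.elim0
      obtain ⟨σ, r', hσ⟩ := fin_perm r i
      obtain ⟨τ, c', hτ⟩ := fin_perm c j
      rw [hi] at hσ
      rw [hj] at hτ
      have hr' : ∀ i, r' i ≠ x := by
        intro k hk
        have h1 : r (σ.symm 0) = r (σ.symm k.succ) := by rw [hσ]; simp [hk]
        exact absurd (σ.symm.injective (hri h1)) (Fin.succ_ne_zero k).symm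
      have hc' : ∀ i, c' i ≠ y := by
        intro k hk
        have h1 : c (τ.symm 0) = c (τ.symm k.succ) := by rw [hτ]; simp [hk]
        exact absurd (τ.symm.injective (hci h1)) (Fin.succ_ne_zero k).symm
      have hs : (Equiv.Perm.sign σ : ℤ) * (Equiv.Perm.sign τ : ℤ) = 1 ∨
          (Equiv.Perm.sign σ : ℤ) * (Equiv.Perm.sign τ : ℤ) = -1 := by
        rcases Int.units_eq_one_or (Equiv.Perm.sign σ) with h | h <;>
        rcases Int.units_eq_one_or (Equiv.Perm.sign τ) with h' | h' <;> simp [h, h']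
      refine ⟨n, r', c', - ((Equiv.Perm.sign σ : ℤ) * (Equiv.Perm.sign τ : ℤ)), by omega, ?_,
        fun F _ _ _ A h => ?_⟩
      · intro k
        exact Or.inr ⟨τ.symm k.succ, by rw [hτ]; simp⟩
      · have e : (piv A x y).submatrix r c = (((piv A x y).submatrix (Fin.cons x r' : Fin (n+1) → X)
            (Fin.cons y c' : Fin (n+1) → Y)).submatrix σ id).submatrix id τ := by
          rw [hσ, hτ]; rfl
        rw [e, Matrix.det_permute', Matrix.det_permute, minor_c A x y r' c' h hr' hc']
        push_cast
        ring
end Dyad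

open Matrix
namespace Dyad

theorem U_mul {z w : K} (h : U z) (h' : U w) : U (z * w) := by
  unfold U at *
  simp only [Prod.fst_mul, Prod.snd_mul, mul_eq_zero, h, h']

theorem U_inv {z : K} (h : U z) : U z⁻¹ := by
  unfold U at *
  simp only [Prod.fst_inv, Prod.snd_inv, inv_eq_zero, h]

theorem U_neg {z : K} (h : U z) : U (-z) := by
  unfold U at *
  simp only [Prod.fst_neg, Prod.snd_neg, neg_eq_zero, h]

theorem U_zero : U 0 := by decide
theorem U_one : U 1 := by decide

section
variable {X Y X' Y' : Type*}

def DLon (S : Set Y) (A : Matrix X Y K) (L : Matrix X Y ℚ) : Prop :=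
  ∀ n (r : Fin n → X) (c : Fin n → Y), (∀ i, c i ∈ S) →
    Lift (L.submatrix r c).det (A.submatrix r c).det

def DL (A : Matrix X Y K) (L : Matrix X Y ℚ) : Prop :=
  ∀ n (r : Fin n → X) (c : Fin n → Y), Lift (L.submatrix r c).det (A.submatrix r c).det

def PM (A : Matrix X Y K) : Prop :=
  ∀ n (r : Fin n → X) (c : Fin n → Y), U (A.submatrix r c).det

variable {A : Matrix X Y K} {L : Matrix X Y ℚ} {S T : Set Y}

theorem DL.on (h : DL A L) : DLon S A L := fun n r c _ => h n r c
theorem DLon.dl (h : DLon Set.univ A L) : DL A L := fun n r c => h n r c (fun _ => trivial)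
theorem DLon.mono (h : DLon S A L) (hT : T ⊆ S) : DLon T A L :=
  fun n r c hc => h n r c (fun i => hT (hc i))

theorem DLon.entry (h : DLon S A L) (x : X) {y : Y} (hy : y ∈ S) : Lift (L x y) (A x y) := by
  have := h 1 ![x] ![y] (by simpa using hy)
  rw [Matrix.det_fin_one, Matrix.det_fin_one] at this
  simpa using this

theorem DLon.minor2 (h : DLon S A L) (i j : X) {u v : Y} (hu : u ∈ S) (hv : v ∈ S) :
    Lift (L i u * L j v - L i v * L j u) (A i u * A j v - A i v * A j u) := by
  have := h 2 ![i, j] ![u, v] (fun k => by fin_cases k <;> simpa)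
  rw [Matrix.det_fin_two, Matrix.det_fin_two] at this
  simpa using this

theorem PM.entry (h : PM A) (x : X) (y : Y) : U (A x y) := by
  have := h 1 ![x] ![y]
  rw [Matrix.det_fin_one] at this
  simpa using this

theorem PM.minor2 (h : PM A) (i j : X) (u v : Y) : U (A i u * A j v - A i v * A j u) := by
  have := h 2 ![i, j] ![u, v]
  rw [Matrix.det_fin_two] at this
  simpa using this

theorem PM.inv (h : PM A) {x : X} {y : Y} (h0 : A x y ≠ 0) : A x y * (A x y)⁻¹ = 1 :=
  U_mul_inv (h.entry x y) h0

theorem Lift.ne {q z} (h : Lift q z) (h0 : z ≠ 0) : q ≠ 0 := fun h' => h0 ((lift_zero_iff h).1 h')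

theorem Lift.inv {q z} (h : Lift q z) (h0 : z ≠ 0) : z * z⁻¹ = 1 :=
  U_mul_inv (lift_U h) h0

theorem U_s {s : ℤ} (h : s = 0 ∨ s = 1 ∨ s = -1) : Lift (s : ℚ) (s : K) := by
  rcases h with rfl | rfl | rfl
  · simpa using lift_zero
  · simpa using lift_one
  · simpa using lift_neg lift_one

theorem PM.piv (h : PM A) {x : X} {y : Y} (h0 : A x y ≠ 0) : PM (piv A x y) := by
  intro n r c
  obtain ⟨n', r', c', s, hs, -, H⟩ := piv_minor r c x y
  rw [H K A (h.inv h0)]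
  exact U_mul (U_mul (lift_U (U_s hs)) (U_inv (h.entry x y))) (h _ _ _)

theorem DLon.piv (h : DLon S A L) {x : X} {y : Y} (hy : y ∈ S) (h0 : A x y ≠ 0) :
    DLon S (piv A x y) (piv L x y) := by
  intro n r c hc
  obtain ⟨n', r', c', s, hs, h2, H⟩ := piv_minor r c x y
  have he := h.entry x hy
  rw [H K A (he.inv h0), H ℚ L (mul_inv_cancel₀ (he.ne h0))]
  refine lift_mul (lift_mul (U_s hs) (lift_inv he)) (h _ _ _ ?_)
  intro i
  rcases h2 i with h3 | ⟨j, h3⟩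
  · rwa [h3]
  · rw [h3]; exact hc j

theorem DL.piv (h : DL A L) {x : X} {y : Y} (h0 : A x y ≠ 0) :
    DL (piv A x y) (piv L x y) := (DLon.piv (S := Set.univ) h.on trivial h0).dl

theorem DLon.sub (h : DLon S A L) (f : X' → X) (g : Y' → Y) {T : Set Y'} (hg : ∀ y ∈ T, g y ∈ S) :
    DLon T (A.submatrix f g) (L.submatrix f g) :=
  fun n r c hc => h n (f ∘ r) (g ∘ c) (fun i => hg _ (hc i))

theorem PM.sub (h : PM A) (f : X' → X) (g : Y' → Y) : PM (A.submatrix f g) :=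
  fun n r c => h n (f ∘ r) (g ∘ c)

theorem PM.tr (h : PM A) : PM Aᵀ := by
  intro n r c
  rw [← Matrix.transpose_submatrix, Matrix.det_transpose]
  exact h n c r

theorem DL.tr (h : DL A L) : DL Aᵀ Lᵀ := by
  intro n r c
  rw [← Matrix.transpose_submatrix, Matrix.det_transpose, ← Matrix.transpose_submatrix,
    Matrix.det_transpose]
  exact h n c r

theorem DLon.congr (h : DLon S A L) {L' : Matrix X Y ℚ} (hL : ∀ x, ∀ y ∈ S, L' x y = L x y) :
    DLon S A L' := by
  intro n r c hc
  convert h n r c hc using 2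
  ext i j
  exact hL _ _ (hc j)

theorem det_scale {F : Type*} [CommRing F] {n : ℕ} (M : Matrix X Y F) (f : X → F) (g : Y → F)
    (r : Fin n → X) (c : Fin n → Y) :
    ((Matrix.of fun x y => f x * M x y * g y).submatrix r c).det =
      (∏ i, f (r i)) * (M.submatrix r c).det * ∏ i, g (c i) := by
  rw [← Matrix.det_mul_column (fun i => f (r i)), mul_comm, ← Matrix.det_mul_row (fun i => g (c i))]
  congr 1
  ext i j
  simp [mul_comm]

theorem lift_prod {ι : Type*} (s : Finset ι) (f : ι → ℚ) (g : ι → K) (h : ∀ i, Lift (f i) (g i)) :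
    Lift (∏ i ∈ s, f i) (∏ i ∈ s, g i) := by
  classical
  induction s using Finset.induction_on with
  | empty => simpa using lift_one
  | insert a s ha ih => rw [Finset.prod_insert ha, Finset.prod_insert ha]; exact lift_mul (h a) ih

theorem DLon.scale (h : DLon S A L) {f : X → ℚ} {g : Y → ℚ} {f' : X → K} {g' : Y → K}
    (hf : ∀ x, Lift (f x) (f' x)) (hg : ∀ x, Lift (g x) (g' x)) :
    DLon S (Matrix.of fun x y => f' x * A x y * g' y) (Matrix.of fun x y => f x * L x y * g y) := by
  intro n r c hc
  rw [det_scale, det_scale]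
  exact lift_mul (lift_mul (lift_prod _ _ _ fun _ => hf _) (h n r c hc))
    (lift_prod _ _ _ fun _ => hg _)

theorem DLon.scale1 (h : DLon S A L) {f : X → ℚ} {g : Y → ℚ}
    (hf : ∀ x, Lift (f x) 1) (hg : ∀ x, Lift (g x) 1) :
    DLon S A (Matrix.of fun x y => f x * L x y * g y) := by
  have := h.scale hf hg
  convert this using 1
  ext i j <;> simp

open Classical in
theorem piv_piv {F : Type*} [CommRing F] [Inv F] [InvOK F] (A : Matrix X Y F) {x : X} {y : Y}
    (h : A x y * (A x y)⁻¹ = 1) : A = Matrix.of (fun x' y' =>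
      (if x' = x then -1 else 1) * (piv (piv A x y) x y) x' y' * (if y' = y then -1 else 1)) := by
  have h2 : (-(A x y)⁻¹)⁻¹ = - A x y := InvOK.ok _ _ (by linear_combination h)
  ext x' y'
  by_cases hx : x' = x <;> by_cases hy : y' = y <;> simp [Dyad.piv, hx, hy, h2]
  · linear_combination (-A x y') * h
  · linear_combination (-A x' y) * h
  · linear_combination (-(A x' y * A x y' * (A x y)⁻¹)) * h

theorem DL.unpiv (hA : PM A) {x : X} {y : Y} (h0 : A x y ≠ 0) (h : DL (Dyad.piv A x y) L) :
    ∃ L', DL A L' := by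
  classical
  have hi := hA.inv h0
  have hn : (Dyad.piv A x y) x y ≠ 0 := by
    rw [piv_xy]
    intro h'
    have h2 : (A x y)⁻¹ = 0 := by simpa using h'
    rw [h2, mul_zero] at hi
    exact absurd hi (by decide)
  have h2 := (DLon.scale (S := Set.univ) (h.piv hn).on
    (f := fun x' => if x' = x then -1 else 1) (f' := fun x' => if x' = x then -1 else 1)
    (g := fun x' => if x' = y then -1 else 1) (g' := fun x' => if x' = y then -1 else 1)
    (fun x' => by split_ifs; exacts [lift_neg lift_one, lift_one])
    (fun x' => by split_ifs; exacts [lift_neg lift_one, lift_one])).dl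
  rw [← piv_piv A hi] at h2
  exact ⟨_, h2⟩

theorem CL1 {u v : Y} (huv : u ≠ v) (P : Matrix X Y K → Matrix X Y ℚ → Prop)
    (hP1 : ∀ A L, P A L → DLon {u}ᶜ A L ∧ DLon {v}ᶜ A L ∧ ∀ i j,
      Lift (L i u * L j v - L i v * L j u) (A i u * A j v - A i v * A j u))
    (hP2 : ∀ A L x y, P A L → y ≠ u → y ≠ v → A x y ≠ 0 → P (Dyad.piv A x y) (Dyad.piv L x y)) :
    ∀ A L, P A L → DL A L := by
  intro A L hAL n
  induction n generalizing A L with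
  | zero => intro r c; simpa using lift_one
  | succ n ih =>
  intro r c
  obtain ⟨h1, h2, h3⟩ := hP1 A L hAL
  by_cases hri : Function.Injective r
  swap
  · simp only [Function.Injective, not_forall] at hri
    obtain ⟨i, j, hij, hne⟩ := hri
    rw [Matrix.det_zero_of_row_eq hne, Matrix.det_zero_of_row_eq hne]
    · exact lift_zero
    · funext k; simp [hij]
    · funext k; simp [hij]
  by_cases hci : Function.Injective c
  swap
  · simp only [Function.Injective, not_forall] at hci
    obtain ⟨i, j, hij, hne⟩ := hci
    rw [Matrix.det_zero_of_column_eq hne, Matrix.det_zero_of_column_eq hne]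
    · exact lift_zero
    · intro k; simp [hij]
    · intro k; simp [hij]
  by_cases hu : ∀ i, c i ≠ u
  · exact h1 _ _ _ hu
  by_cases hv : ∀ i, c i ≠ v
  · exact h2 _ _ _ hv
  push Not at hu hv
  obtain ⟨a, ha⟩ := hu
  obtain ⟨b, hb⟩ := hv
  by_cases hk : ∃ k, c k ≠ u ∧ c k ≠ v
  · obtain ⟨k, hku, hkv⟩ := hk
    by_cases hz : ∀ i, A (r i) (c k) = 0
    · have hz' : ∀ i, L (r i) (c k) = 0 := fun i => (lift_zero_iff (h1.entry (r i) hku)).2 (hz i)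
      rw [Matrix.det_eq_zero_of_column_eq_zero k hz', Matrix.det_eq_zero_of_column_eq_zero k hz]
      exact lift_zero
    push Not at hz
    obtain ⟨i, hi⟩ := hz
    obtain ⟨σ, r', hσ⟩ := fin_perm r i
    obtain ⟨τ, c', hτ⟩ := fin_perm c k
    have hent := h1.entry (r i) hku
    have hA := hent.inv hi
    have hL := mul_inv_cancel₀ (hent.ne hi)
    have ih2 := ih _ _ (hP2 A L (r i) (c k) hAL hku hkv hi) r' c'
    generalize r i = x at *
    generalize c k = y at *
    have hr' : ∀ i, r' i ≠ x := by
      intro k hk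
      have h1 : r (σ.symm 0) = r (σ.symm k.succ) := by rw [hσ]; simp [hk]
      exact absurd (σ.symm.injective (hri h1)) (Fin.succ_ne_zero k).symm
    have hc' : ∀ i, c' i ≠ y := by
      intro k hk
      have h1 : c (τ.symm 0) = c (τ.symm k.succ) := by rw [hτ]; simp [hk]
      exact absurd (τ.symm.injective (hci h1)) (Fin.succ_ne_zero k).symm
    have key : ∀ (F : Type) [CommRing F] [Inv F] [InvOK F] (A : Matrix X Y F),
        A x y * (A x y)⁻¹ = 1 → (A.submatrix r c).det =
        ((Equiv.Perm.sign σ : ℤ) : F) * ((Equiv.Perm.sign τ : ℤ) : F) * (A x y *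
          ((Dyad.piv A x y).submatrix r' c').det) := by
      intro F _ _ _ A h
      have e : A.submatrix r c = ((A.submatrix (Fin.cons x r' : Fin (n+1) → X)
            (Fin.cons y c' : Fin (n+1) → Y)).submatrix σ id).submatrix id τ := by
          rw [hσ, hτ]; rfl
      rw [e, Matrix.det_permute', Matrix.det_permute, minor_a A x y r' c' h hr' hc',
        ← mul_assoc (A x y), h]
      ring
    rw [key K A hA, key ℚ L hL]
    refine lift_mul (lift_mul (U_s ?_) (U_s ?_)) (lift_mul hent ih2)
    · rcases Int.units_eq_one_or (Equiv.Perm.sign σ) with h | h <;> simp [h]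
    · rcases Int.units_eq_one_or (Equiv.Perm.sign τ) with h | h <;> simp [h]
  · push Not at hk
    have hab : a ≠ b := by rintro rfl; exact huv (ha.symm.trans hb)
    have hall : ∀ k, k = a ∨ k = b := by
      intro k
      by_cases h : c k = u
      · left; exact hci (h.trans ha.symm)
      · right; exact hci ((hk k h).trans hb.symm)
    have hn : n = 1 := by
      have h4 : (Finset.univ : Finset (Fin (n+1))) = {a, b} := by ext k; simpa using hall k
      have h5 := congrArg Finset.card h4
      rw [Finset.card_pair hab] at h5
      simpa using h5
    subst hn
    rw [Matrix.det_fin_two, Matrix.det_fin_two]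
    simp only [Matrix.submatrix_apply]
    fin_cases a <;> fin_cases b
    · exact absurd rfl hab
    · simp only [Fin.zero_eta, Fin.mk_one] at ha hb
      rw [ha, hb]; exact h3 _ _
    · simp only [Fin.zero_eta, Fin.mk_one] at ha hb
      rw [ha, hb]
      have := lift_neg (h3 (r 0) (r 1))
      simpa using this
    · exact absurd rfl hab

end
end Dyad

open Matrix
namespace Dyad

section scalars

theorem F1_of_minor {a b c d : ℚ} {a' b' c' d' w : K} (ha : Lift a a') (hb : Lift b b')
    (hc : Lift c c') (hd : Lift d d') (ha0 : a' ≠ 0) (hb0 : b' ≠ 0) (hc0 : c' ≠ 0) (hd0 : d' ≠ 0)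
    (h : Lift (a * d - b * c) w) :
    F1 (a * d * (b * c)⁻¹) ∧ Lift (a * d * (b * c)⁻¹) (a' * d' * (b' * c')⁻¹) := by
  have h1 := lift_mul (lift_mul ha hd) (lift_inv (lift_mul hb hc))
  have := ha.ne ha0
  have := hb.ne hb0
  have := hc.ne hc0
  have := hd.ne hd0
  refine ⟨F1_of_lift h1 (by positivity) (w := - w * (b' * c')⁻¹) ?_, h1⟩
  convert lift_mul (lift_neg h) (lift_inv (lift_mul hb hc)) using 1
  field_simp
  ring

theorem U_ratio {a' b' c' d' : K} (hb : U b') (hc : U c') (hb0 : b' ≠ 0) (hc0 : c' ≠ 0)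
    (h : U (a' * d' - b' * c')) : U (1 - a' * d' * (b' * c')⁻¹) ∧ (b' * c') * (b' * c')⁻¹ = 1 := by
  have e : (b' * c') * (b' * c')⁻¹ = 1 := by
    rw [mul_inv]
    linear_combination U_mul_inv hb hb0 + (b' * b'⁻¹) * (U_mul_inv hc hc0) 
  refine ⟨?_, e⟩
  have : 1 - a' * d' * (b' * c')⁻¹ = - (a' * d' - b' * c') * (b' * c')⁻¹ := by
    linear_combination - e
  rw [this]
  exact U_mul (U_neg h) (U_inv (U_mul hb hc))

theorem minor_of_F1 {a b c d : ℚ} {a' b' c' d' : K} (ha : Lift a a') (hb : Lift b b')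
    (hc : Lift c c') (hd : Lift d d') (hb0 : b' ≠ 0) (hc0 : c' ≠ 0)
    (h : F1 (a * d * (b * c)⁻¹)) : Lift (a * d - b * c) (a' * d' - b' * c') := by
  have h1 := lift_mul (lift_mul ha hd) (lift_inv (lift_mul hb hc))
  have h2 := lift_mul (lift_neg (lift_of_F1 h h1)) (lift_mul hb hc)
  have := hb.ne hb0
  have := hc.ne hc0
  have e : (b' * c') * (b' * c')⁻¹ = 1 := by
    rw [mul_inv]
    linear_combination U_mul_inv (lift_U hb) hb0 + (b' * b'⁻¹) * (U_mul_inv (lift_U hc) hc0)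
  convert h2 using 1
  · field_simp
    ring
  · linear_combination (- a' * d') * e

theorem minor_comp {a b c d e f : ℚ} {a' b' c' d' e' f' w1 w2 : K} (ha : Lift a a') (hb : Lift b b')
    (hc : Lift c c') (hd : Lift d d') (he : Lift e e') (hf : Lift f f')
    (ha0 : a' ≠ 0) (hb0 : b' ≠ 0) (hc0 : c' ≠ 0) (hd0 : d' ≠ 0) (he0 : e' ≠ 0) (hf0 : f' ≠ 0)
    (h1 : Lift (a * f - e * c) w1) (h2 : Lift (e * d - b * f) w2) (hu : U (a' * d' - b' * c')) :
    Lift (a * d - b * c) (a' * d' - b' * c') := by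
  obtain ⟨p1, q1⟩ := F1_of_minor ha he hc hf ha0 he0 hc0 hf0 h1
  obtain ⟨p2, q2⟩ := F1_of_minor he hb hf hd he0 hb0 hf0 hd0 h2
  have hbn := hb.ne hb0
  have hcn := hc.ne hc0
  have hen := he.ne he0
  have hfn := hf.ne hf0
  have he1 := he.inv he0
  have hf1 := hf.inv hf0
  apply minor_of_F1 ha hb hc hd hb0 hc0
  have key := F1_mul p1 p2 q1 q2 ?_
  · convert key using 1
    field_simp
  · convert (U_ratio (lift_U hb) (lift_U hc) hb0 hc0 hu).1 using 2
    simp only [mul_inv]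
    linear_combination (a' * d' * b'⁻¹ * c'⁻¹) * (he1 + e' * e'⁻¹ * hf1)

theorem minor_neg {s t : ℚ} {s' t' w : K} (hs : Lift s s') (ht : Lift t t')
    (hs0 : s' ≠ 0) (ht0 : t' ≠ 0) (h : Lift (s + t) w) (hu : U (s' - t')) :
    Lift (s - t) (s' - t') := by
  obtain ⟨p, q⟩ := F1_of_minor (lift_neg hs) ht lift_one lift_one (by simpa using hs0) ht0
    (by decide) (by decide) (w := - w) (by convert lift_neg h using 1; ring)
  have h3 := (U_ratio (a' := s') (d' := 1) (lift_U ht) U_one ht0 (by decide)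
    (by simpa using hu)).1
  have := F1_neg p q (by convert h3 using 1; ring)
  have h4 := minor_of_F1 hs ht lift_one lift_one ht0 (by decide) (by convert this using 1; ring)
  simpa using h4

end scalars

section
variable {X Y : Type*}

def Rel (S : Set Y) (A : Matrix X Y K) (i k : X) : Prop := ∃ y ∈ S, A i y ≠ 0 ∧ A k y ≠ 0

def CN (S : Set Y) (A : Matrix X Y K) : ℕ → X → X → Prop
  | 0, i, j => i = j
  | n + 1, i, j => ∃ k, Rel S A i k ∧ CN S A n k j

variable {A : Matrix X Y K} {L : Matrix X Y ℚ} {S T : Set Y}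

theorem ne_zero_mul {z w : K} (hz : U z) (hw : U w) (h1 : z ≠ 0) (h2 : w ≠ 0) : z * w ≠ 0 := by
  intro h
  have := U_mul_inv hz h1
  apply h2
  linear_combination (-w) * this + z⁻¹ * h

theorem U_inv_ne {z : K} (hz : U z) (h1 : z ≠ 0) : z⁻¹ ≠ 0 := by
  intro h
  have := U_mul_inv hz h1
  rw [h, mul_zero] at this
  exact absurd this (by decide)

theorem shrink1 (hA : PM A) {n : ℕ} {i j : X} (h : CN S A (n + 3) i j)
    (hmin : ∀ m < n + 3, ¬ CN S A m i j) :
    ∃ x, ∃ y ∈ S, A x y ≠ 0 ∧ A i y = 0 ∧ A j y = 0 ∧ i ≠ x ∧ j ≠ x ∧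
      CN S (piv A x y) (n + 2) i j := by
  obtain ⟨x1, ⟨y1, hy1, hi1, hx1⟩, x2, ⟨y2, hy2, hx12, hx2⟩, x3, ⟨y3, hy3, hx23, hx3⟩, ht⟩ := h
  have far : ∀ t ≤ n, ∀ w, CN S A t w j → A w y2 = 0 := by
    intro t ht w hw
    by_contra hne
    exact hmin (t + 2) (by omega) ⟨x1, ⟨y1, hy1, hi1, hx1⟩, w, ⟨y2, hy2, hx12, hne⟩, hw⟩
  have hiy : A i y2 = 0 := by
    by_contra hne
    exact hmin (n + 2) (by omega) ⟨x2, ⟨y2, hy2, hne, hx2⟩, x3, ⟨y3, hy3, hx23, hx3⟩, ht⟩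
  have hx2y1 : A x2 y1 = 0 := by
    by_contra hne
    exact hmin (n + 2) (by omega) ⟨x2, ⟨y1, hy1, hi1, hne⟩, x3, ⟨y3, hy3, hx23, hx3⟩, ht⟩
  have hx1y3 : A x1 y3 = 0 := by
    by_contra hne
    exact hmin (n + 2) (by omega) ⟨x1, ⟨y1, hy1, hi1, hx1⟩, x3, ⟨y3, hy3, hne, hx3⟩, ht⟩
  have hjy := far 0 (by omega) j rfl
  have hx3y2 := far n le_rfl x3 ht
  have nx : ∀ w, A w y2 = 0 → w ≠ x1 := by rintro w h rfl; exact hx12 h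
  have ny : ∀ w y, A w y2 = 0 → A w y ≠ 0 → y ≠ y2 := by rintro w y h h' rfl; exact h' h
  have stay : ∀ w y, A w y2 = 0 → A w y ≠ 0 → piv A x1 y2 w y ≠ 0 := by
    intro w y h h'
    rw [piv_o A x1 y2 (nx w h) (ny w y h h'), h]
    simpa using h'
  have hx21 : x2 ≠ x1 := by rintro rfl; exact hx1 hx2y1
  refine ⟨x1, y2, hy2, hx12, hiy, hjy, nx i hiy, nx j hjy, x2, ⟨y1, hy1, stay i y1 hiy hi1, ?_⟩, x3,
    ⟨y3, hy3, ?_, stay x3 y3 hx3y2 hx3⟩, ?_⟩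
  · rw [piv_o A x1 y2 hx21 (ny i y1 hiy hi1), hx2y1, zero_sub]
    apply neg_ne_zero.2
    exact ne_zero_mul (U_mul (hA.entry _ _) (hA.entry _ _)) (U_inv (hA.entry _ _))
      (ne_zero_mul (hA.entry _ _) (hA.entry _ _) hx2 hx1) (U_inv_ne (hA.entry _ _) hx12)
  · rw [piv_o A x1 y2 hx21 (ny x3 y3 hx3y2 hx3), hx1y3]
    simpa using hx23
  · have : ∀ t ≤ n, ∀ w, CN S A t w j → CN S (piv A x1 y2) t w j := by
      intro t
      induction t with
      | zero => intro _ w hw; exact hw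
      | succ t ih =>
        rintro htn w ⟨w', ⟨y, hy, h1, h2⟩, h3⟩
        exact ⟨w', ⟨y, hy, stay w y (far (t+1) htn w ⟨w', ⟨y, hy, h1, h2⟩, h3⟩) h1,
          stay w' y (far t (by omega) w' h3) h2⟩, ih (by omega) w' h3⟩
    exact this n le_rfl x3 ht

theorem piv_row {F : Type*} [CommRing F] [Inv F] (A : Matrix X Y F) {x i : X} {y w : Y}
    (hx : i ≠ x) (h : w ≠ y) (h0 : A i y = 0 ∨ A x w = 0) : piv A x y i w = A i w := by
  rw [piv_o A x y hx h]
  rcases h0 with h0 | h0 <;> simp [h0]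

end
end Dyad

open Matrix
namespace Dyad

section
variable {X Y : Type*} {A : Matrix X Y K} {L : Matrix X Y ℚ} {S T : Set Y} {u v : Y}

def off (u v : Y) : Set Y := {y | y ≠ u ∧ y ≠ v}

theorem off_comm : off u v = off v u := by ext y; simp [off, and_comm]

structure Good (u v : Y) (A : Matrix X Y K) (L : Matrix X Y ℚ) : Prop where
  uv : u ≠ v
  pm : PM A
  du : DLon {u}ᶜ A L
  dv : DLon {v}ᶜ A L

theorem Good.symm (h : Good u v A L) : Good v u A L := ⟨h.uv.symm, h.pm, h.dv, h.du⟩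

theorem Good.entry (h : Good u v A L) (x : X) (y : Y) : Lift (L x y) (A x y) := by
  by_cases hy : y = u
  · subst hy; exact h.dv.entry x h.uv
  · exact h.du.entry x hy

theorem Good.piv (h : Good u v A L) {x : X} {y : Y} (hy : y ∈ off u v) (h0 : A x y ≠ 0) :
    Good u v (piv A x y) (piv L x y) :=
  ⟨h.uv, h.pm.piv h0, h.du.piv hy.1 h0, h.dv.piv hy.2 h0⟩

theorem Good.zero (h : Good u v A L) {i j : X}
    (h0 : A i u = 0 ∨ A i v = 0 ∨ A j u = 0 ∨ A j v = 0) :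
    Lift (L i u * L j v - L i v * L j u) (A i u * A j v - A i v * A j u) := by
  have e := h.entry
  rcases h0 with h0 | h0 | h0 | h0
  · have h1 := (lift_zero_iff (e i u)).2 h0
    simpa [h0, h1] using lift_neg (lift_mul (e i v) (e j u))
  · have h1 := (lift_zero_iff (e i v)).2 h0
    simpa [h0, h1] using (lift_mul (e i u) (e j v))
  · have h1 := (lift_zero_iff (e j u)).2 h0
    simpa [h0, h1] using (lift_mul (e i u) (e j v))
  · have h1 := (lift_zero_iff (e j v)).2 h0
    simpa [h0, h1] using lift_neg (lift_mul (e i v) (e j u))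

theorem Good.one (h : Good u v A L) {i j : X} (hr : Rel (off u v) A i j) :
    Lift (L i u * L j v - L i v * L j u) (A i u * A j v - A i v * A j u) := by
  by_cases h0 : A i u = 0 ∨ A i v = 0 ∨ A j u = 0 ∨ A j v = 0
  · exact h.zero h0
  push Not at h0
  obtain ⟨h1, h2, h3, h4⟩ := h0
  obtain ⟨y, hy, hiy, hjy⟩ := hr
  exact minor_comp (h.entry i u) (h.entry i v) (h.entry j u) (h.entry j v) (h.entry i y)
    (h.entry j y) h1 h2 h3 h4 hiy hjy (h.dv.minor2 i j h.uv hy.2) (h.du.minor2 i j hy.1 h.uv.symm)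
    (h.pm.minor2 i j u v)

theorem zero_of {q : ℚ} {z : K} (h : Lift q z) (h0 : z = 0) : q = 0 := (lift_zero_iff h).2 h0

theorem Good.two_aux (h : Good u v A L) {i j x : X} {y1 y2 : Y} (hy1 : y1 ∈ off u v)
    (hi1 : A i y1 ≠ 0) (hx1 : A x y1 ≠ 0) (hj1 : A j y1 = 0)
    (hi2 : A i y2 = 0) (hx2 : A x y2 ≠ 0) (hj2 : A j y2 ≠ 0) (hy2 : y2 ∈ off u v) :
    Lift ((L i u - L i y1 * L x u * (L x y1)⁻¹) * L j v
        - (L i v - L i y1 * L x v * (L x y1)⁻¹) * L j u)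
      ((A i u - A i y1 * A x u * (A x y1)⁻¹) * A j v
        - (A i v - A i y1 * A x v * (A x y1)⁻¹) * A j u) := by
  have hix : i ≠ x := by rintro rfl; exact hx2 hi2
  have hjx : j ≠ x := by rintro rfl; exact hx1 hj1
  have hyy : y2 ≠ y1 := by rintro rfl; exact hi1 hi2
  have hr : Rel (off u v) (Dyad.piv A x y1) i j := by
    refine ⟨y2, hy2, ?_, ?_⟩
    · rw [piv_o A x y1 hix hyy, hi2, zero_sub]
      apply neg_ne_zero.2
      exact ne_zero_mul (U_mul (h.pm.entry _ _) (h.pm.entry _ _)) (U_inv (h.pm.entry _ _))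
        (ne_zero_mul (h.pm.entry _ _) (h.pm.entry _ _) hi1 hx2) (U_inv_ne (h.pm.entry _ _) hx1)
    · rw [piv_row A hjx hyy (Or.inl hj1)]; exact hj2
  have := (h.piv hy1 hx1).one hr
  have hj1' := zero_of (h.entry j y1) hj1
  rwa [piv_row A hjx hy1.1.symm (Or.inl hj1), piv_row A hjx hy1.2.symm (Or.inl hj1),
    piv_row L hjx hy1.1.symm (Or.inl hj1'), piv_row L hjx hy1.2.symm (Or.inl hj1'),
    piv_o A x y1 hix hy1.1.symm, piv_o A x y1 hix hy1.2.symm,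
    piv_o L x y1 hix hy1.1.symm, piv_o L x y1 hix hy1.2.symm] at this

theorem Good.two_half (h : Good u v A L) {i j x : X} {y1 y2 : Y} (hy1 : y1 ∈ off u v)
    (hi1 : A i y1 ≠ 0) (hx1 : A x y1 ≠ 0) (hj1 : A j y1 = 0)
    (hi2 : A i y2 = 0) (hx2 : A x y2 ≠ 0) (hj2 : A j y2 ≠ 0) (hy2 : y2 ∈ off u v)
    (h1 : A i u ≠ 0) (h2 : A i v ≠ 0) (h3 : A j u ≠ 0) (h4 : A j v ≠ 0)
    (hxu : A x u ≠ 0) (hxv : A x v = 0) (hcr : A i u - A i y1 * A x u * (A x y1)⁻¹ ≠ 0) :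
    Lift (L i u * L j v - L i v * L j u) (A i u * A j v - A i v * A j u) := by
  have e := h.entry
  have hxv' := zero_of (e x v) hxv
  have h5 := h.two_aux hy1 hi1 hx1 hj1 hi2 hx2 hj2 hy2
  rw [hxv, hxv', mul_zero, zero_mul, sub_zero, mul_zero, zero_mul, sub_zero] at h5
  have h6 : Lift (L i u - L i y1 * L x u * (L x y1)⁻¹) (A i u - A i y1 * A x u * (A x y1)⁻¹) := by
    have h7 := lift_mul (h.dv.minor2 i x h.uv hy1.2) (lift_inv (e x y1))
    have hn := (e x y1).ne hx1
    convert h7 using 1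
    · field_simp
    · linear_combination (-A i u) * (e x y1).inv hx1
  refine minor_comp (e i u) (e i v) (e j u) (e j v) h6 (e j u) h1 h2 h3 h4 hcr h3
    (w1 := A j u * (A i y1 * A x u * (A x y1)⁻¹)) ?_ h5 (h.pm.minor2 i j u v)
  convert lift_mul (e j u) (lift_mul (lift_mul (e i y1) (e x u)) (lift_inv (e x y1))) using 1
  ring

theorem minor_swap {A : Matrix X Y K} {L : Matrix X Y ℚ} {i j : X}
    (h : Lift (L j u * L i v - L j v * L i u) (A j u * A i v - A j v * A i u)) :
    Lift (L i u * L j v - L i v * L j u) (A i u * A j v - A i v * A j u) := by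
  convert lift_neg h using 1 <;> ring

theorem minor_swap' {A : Matrix X Y K} {L : Matrix X Y ℚ} {i j : X}
    (h : Lift (L i v * L j u - L i u * L j v) (A i v * A j u - A i u * A j v)) :
    Lift (L i u * L j v - L i v * L j u) (A i u * A j v - A i v * A j u) := by
  convert lift_neg h using 1 <;> ring

theorem Good.two_xu (h : Good u v A L) {i j x : X} {y1 y2 : Y} (hy1 : y1 ∈ off u v)
    (hi1 : A i y1 ≠ 0) (hx1 : A x y1 ≠ 0) (hj1 : A j y1 = 0)
    (hi2 : A i y2 = 0) (hx2 : A x y2 ≠ 0) (hj2 : A j y2 ≠ 0) (hy2 : y2 ∈ off u v)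
    (h1 : A i u ≠ 0) (h2 : A i v ≠ 0) (h3 : A j u ≠ 0) (h4 : A j v ≠ 0)
    (hxu : A x u ≠ 0) (hxv : A x v = 0) :
    Lift (L i u * L j v - L i v * L j u) (A i u * A j v - A i v * A j u) := by
  by_cases hcr : A i u - A i y1 * A x u * (A x y1)⁻¹ = 0
  swap
  · exact h.two_half hy1 hi1 hx1 hj1 hi2 hx2 hj2 hy2 h1 h2 h3 h4 hxu hxv hcr
  by_cases hcr2 : A j u - A j y2 * A x u * (A x y2)⁻¹ = 0
  swap
  · exact minor_swap (h.two_half hy2 hj2 hx2 hi2 hj1 hx1 hi1 hy1 h3 h4 h1 h2 hxu hxv hcr2)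
  have e := h.entry
  have hxv' := zero_of (e x v) hxv
  have hix : i ≠ x := by rintro rfl; exact hx2 hi2
  have hjx : j ≠ x := by rintro rfl; exact hx1 hj1
  have hyy : y2 ≠ y1 := by rintro rfl; exact hi1 hi2
  have h5 : Lift (L i u - L i y1 * L x u * (L x y1)⁻¹) (A i u - A i y1 * A x u * (A x y1)⁻¹) := by
    have h7 := lift_mul (h.dv.minor2 i x h.uv hy1.2) (lift_inv (e x y1))
    have hn := (e x y1).ne hx1
    convert h7 using 1
    · field_simp
    · linear_combination (-A i u) * (e x y1).inv hx1
  have h6 : Lift (L j u - L j y2 * L x u * (L x y2)⁻¹) (A j u - A j y2 * A x u * (A x y2)⁻¹) := by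
    have h7 := lift_mul (h.dv.minor2 j x h.uv hy2.2) (lift_inv (e x y2))
    have hn := (e x y2).ne hx2
    convert h7 using 1
    · field_simp
    · linear_combination (-A j u) * (e x y2).inv hx2
  have z5 := zero_of h5 hcr
  have z6 := zero_of h6 hcr2
  have h7 := (h.piv hy1 hx1).du.minor2 i j (u := y2) (v := v) hy2.1 h.uv.symm
  have hj1' := zero_of (e j y1) hj1
  have hi2' := zero_of (e i y2) hi2
  rw [piv_row A hjx hyy (Or.inl hj1), piv_row A hjx hy1.2.symm (Or.inl hj1),
    piv_row L hjx hyy (Or.inl hj1'), piv_row L hjx hy1.2.symm (Or.inl hj1'),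
    piv_o A x y1 hix hyy, piv_row A hix hy1.2.symm (Or.inr hxv),
    piv_o L x y1 hix hyy, piv_row L hix hy1.2.symm (Or.inr hxv'), hi2, hi2'] at h7
  have hn1 := (e x y1).ne hx1
  have hn2 := (e x y2).ne hx2
  have l1 := lift_mul (lift_mul (lift_mul (e i y1) (e x y2)) (lift_inv (e x y1))) (e j v)
  have l2 := lift_mul (e i v) (e j y2)
  have l3 := lift_mul (e x u) (lift_inv (e x y2))
  have m1 := (e x y2).inv hx2
  have p := h.pm.entry
  have hA : A i u * A j v - A i v * A j u = (A i y1 * A x y2 * (A x y1)⁻¹ * A j v -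
      A i v * A j y2) * (A x u * (A x y2)⁻¹) := by
    linear_combination (A j v) * hcr - (A i v) * hcr2 - (A i y1 * A x u * (A x y1)⁻¹ * A j v) * m1
  have hL : L i u * L j v - L i v * L j u = (L i y1 * L x y2 * (L x y1)⁻¹ * L j v -
      L i v * L j y2) * (L x u * (L x y2)⁻¹) := by
    linear_combination (L j v) * z5 - (L i v) * z6 -
      (L i y1 * L x u * (L x y1)⁻¹ * L j v) * (mul_inv_cancel₀ hn2)
  rw [hA, hL]
  refine lift_mul (minor_neg l1 l2 ?_ ?_ (w := - ((0 - A i y1 * A x y2 * (A x y1)⁻¹) * A j v -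
      A i v * A j y2)) ?_ ?_) l3
  · exact ne_zero_mul (U_mul (U_mul (p _ _) (p _ _)) (U_inv (p _ _))) (p _ _)
      (ne_zero_mul (U_mul (p _ _) (p _ _)) (U_inv (p _ _))
        (ne_zero_mul (p _ _) (p _ _) hi1 hx2) (U_inv_ne (p _ _) hx1)) h4
  · exact ne_zero_mul (p _ _) (p _ _) h2 hj2
  · convert lift_neg h7 using 1
    ring
  · have h8 := U_mul (h.pm.minor2 i j u v) (U_mul (p x y2) (U_inv (p x u)))
    rw [hA] at h8
    convert h8 using 1
    have m2 := (e x u).inv hxu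
    linear_combination (- (A i y1 * A x y2 * (A x y1)⁻¹ * A j v - A i v * A j y2)) *
      (m2 + A x u * (A x u)⁻¹ * m1)

theorem Good.two (h : Good u v A L) {i j x : X} {y1 y2 : Y} (hy1 : y1 ∈ off u v)
    (hi1 : A i y1 ≠ 0) (hx1 : A x y1 ≠ 0) (hj1 : A j y1 = 0)
    (hi2 : A i y2 = 0) (hx2 : A x y2 ≠ 0) (hj2 : A j y2 ≠ 0) (hy2 : y2 ∈ off u v) :
    Lift (L i u * L j v - L i v * L j u) (A i u * A j v - A i v * A j u) := by
  by_cases h0 : A i u = 0 ∨ A i v = 0 ∨ A j u = 0 ∨ A j v = 0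
  · exact h.zero h0
  push Not at h0
  obtain ⟨h1, h2, h3, h4⟩ := h0
  have e := h.entry
  by_cases hxu : A x u = 0 <;> by_cases hxv : A x v = 0
  · have h5 := h.two_aux hy1 hi1 hx1 hj1 hi2 hx2 hj2 hy2
    rw [hxv, zero_of (e x v) hxv, hxu, zero_of (e x u) hxu] at h5
    simpa using h5
  · have hs := h.symm
    rw [off_comm] at hy1 hy2
    exact minor_swap' (hs.two_xu hy1 hi1 hx1 hj1 hi2 hx2 hj2 hy2 h2 h1 h4 h3 hxv hxu)
  · exact h.two_xu hy1 hi1 hx1 hj1 hi2 hx2 hj2 hy2 h1 h2 h3 h4 hxu hxv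
  · have r1 := h.one (i := i) (j := x) ⟨y1, hy1, hi1, hx1⟩
    have r2 := h.one (i := x) (j := j) ⟨y2, hy2, hx2, hj2⟩
    have := minor_comp (e i u) (e j u) (e i v) (e j v) (e x u) (e x v) h1 h3 h2 h4 hxu hxv
      (w1 := A i u * A x v - A i v * A x u) (w2 := A x u * A j v - A x v * A j u)
      (by convert r1 using 1; ring) (by convert r2 using 1; ring)
      (by convert h.pm.minor2 i j u v using 1; ring)
    convert this using 1 <;> ring

theorem Good.conn {n : ℕ} : ∀ {A : Matrix X Y K} {L : Matrix X Y ℚ} (_ : Good u v A L) {i j : X}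
    (_ : CN (off u v) A n i j),
    Lift (L i u * L j v - L i v * L j u) (A i u * A j v - A i v * A j u) := by
  induction n using Nat.strong_induction_on with
  | _ n ih =>
  intro A L h i j hc
  by_cases hmin : ∃ m < n, CN (off u v) A m i j
  · obtain ⟨m, hm, hc⟩ := hmin
    exact ih m hm h hc
  push Not at hmin
  match n, ih, hc, hmin with
  | 0, _, hc, _ =>
    cases hc
    convert lift_zero using 1 <;> ring
  | 1, _, hc, _ =>
    obtain ⟨k, hk, hkj⟩ := hc
    cases hkj
    exact h.one hk
  | 2, _, hc, hmin =>
    obtain ⟨x, ⟨y1, hy1, a1, a2⟩, k, ⟨y2, hy2, b1, b2⟩, hkj⟩ := hc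
    cases hkj
    refine h.two hy1 a1 a2 ?_ ?_ b1 b2 hy2
    · by_contra hne
      exact hmin 1 (by omega) ⟨j, ⟨y1, hy1, a1, hne⟩, rfl⟩
    · by_contra hne
      exact hmin 1 (by omega) ⟨j, ⟨y2, hy2, hne, b2⟩, rfl⟩
  | n + 3, ih, hc, hmin =>
    obtain ⟨x, y, hy, hxy, hi, hj, hix, hjx, hc'⟩ := shrink1 h.pm hc hmin
    have := ih (n + 2) (by omega) (h.piv hy hxy) hc'
    have hi' := zero_of (h.entry i y) hi
    have hj' := zero_of (h.entry j y) hj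
    rwa [piv_row A hjx hy.1.symm (Or.inl hj), piv_row A hjx hy.2.symm (Or.inl hj),
      piv_row L hjx hy.1.symm (Or.inl hj'), piv_row L hjx hy.2.symm (Or.inl hj'),
      piv_row A hix hy.1.symm (Or.inl hi), piv_row A hix hy.2.symm (Or.inl hi),
      piv_row L hix hy.1.symm (Or.inl hi'), piv_row L hix hy.2.symm (Or.inl hi')] at this
end
end Dyad

open Matrix
namespace Dyad

section
variable {X Y : Type*} {A : Matrix X Y K} {L L1 L2 : Matrix X Y ℚ} {S T : Set Y} {u v : Y}

def Cn (S : Set Y) (A : Matrix X Y K) : X → X → Prop := Relation.ReflTransGen (Rel S A)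

theorem Rel.symm {i j : X} (h : Rel S A i j) : Rel S A j i := by
  obtain ⟨y, hy, a, b⟩ := h
  exact ⟨y, hy, b, a⟩

theorem Cn.symm {i j : X} (h : Cn S A i j) : Cn S A j i := by
  induction h with
  | refl => exact Relation.ReflTransGen.refl
  | tail _ h ih => exact Relation.ReflTransGen.head h.symm ih

theorem Cn.trans {i j k : X} (h : Cn S A i j) (h' : Cn S A j k) : Cn S A i k :=
  Relation.ReflTransGen.trans h h'

theorem Cn.refl (i : X) : Cn S A i i := Relation.ReflTransGen.refl

theorem Rel.cn {i j : X} (h : Rel S A i j) : Cn S A i j := Relation.ReflTransGen.single h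

theorem Cn.cN {i j : X} (h : Cn S A i j) : ∃ n, CN S A n i j := by
  induction h using Relation.ReflTransGen.head_induction_on with
  | refl => exact ⟨0, rfl⟩
  | head h _ ih => obtain ⟨n, hn⟩ := ih; exact ⟨n+1, _, h, hn⟩

theorem Good.cn (h : Good u v A L) {i j : X} (hc : Cn (off u v) A i j) :
    Lift (L i u * L j v - L i v * L j u) (A i u * A j v - A i v * A j u) := by
  obtain ⟨n, hn⟩ := hc.cN
  exact h.conn hn

/-- uniqueness of the lift of an additional column, up to class scaling -/
theorem Qlem (hA : PM A) (hu : u ∉ S) (h1 : DLon (insert u S) A L1) (h2 : DLon (insert u S) A L2)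
    (heq : ∀ x, ∀ y ∈ S, L1 x y = L2 x y) {i j : X} (hc : Cn S A i j) :
    L1 i u * L2 j u = L2 i u * L1 j u := by
  let g : Bool ⊕ S → Y := Sum.elim (fun _ => u) Subtype.val
  let A' : Matrix X (Bool ⊕ S) K := A.submatrix id g
  let L' : Matrix X (Bool ⊕ S) ℚ := Matrix.of fun x y =>
    match y with
    | Sum.inl true => L1 x u
    | Sum.inl false => L2 x u
    | Sum.inr s => L1 x s
  have hg : ∀ y, g y ∈ insert u S := by
    rintro (b | s)
    · exact Or.inl rfl
    · exact Or.inr s.2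
  have good : Good (Sum.inl true) (Sum.inl false) A' L' := by
    refine ⟨by simp, hA.sub _ _, ?_, ?_⟩
    · refine (h2.sub id g (T := {Sum.inl true}ᶜ) (fun y _ => hg y)).congr ?_
      rintro x ((_ | _) | s) hy
      · rfl
      · simp at hy
      · exact heq x s s.2
    · refine (h1.sub id g (T := {Sum.inl false}ᶜ) (fun y _ => hg y)).congr ?_
      rintro x ((_ | _) | s) hy
      · simp at hy
      · rfl
      · rfl
  have hc' : Cn (off (Sum.inl true) (Sum.inl false)) A' i j := by
    refine Relation.ReflTransGen.mono ?_ _ _ hc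
    rintro a b ⟨y, hy, ha, hb⟩
    exact ⟨Sum.inr ⟨y, hy⟩, ⟨by simp, by simp⟩, ha, hb⟩
  have h3 := good.cn hc'
  have h4 := (lift_zero_iff h3).2 (by simp [A', g])
  simp only [L', Matrix.of_apply] at h4
  linarith

theorem classScale (q : X → ℚ)
    (hq1 : ∀ x, A x u ≠ 0 → Lift (q x) 1)
    (hq : ∀ i j, A i u ≠ 0 → A j u ≠ 0 → Cn S A i j → q i = q j) :
    ∃ (f : X → ℚ) (g : Y → ℚ), (∀ x, Lift (f x) 1) ∧ (∀ y, Lift (g y) 1) ∧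
      (∀ i, A i u ≠ 0 → f i = q i) ∧ ∀ x, ∀ y ∈ S, A x y ≠ 0 → f x * g y = 1 := by
  classical
  let F : (X → Prop) → ℚ := fun P => if h : ∃ i, P i then q h.choose else 1
  let f : X → ℚ := fun x => F (fun i => A i u ≠ 0 ∧ Cn S A x i)
  have hf : ∀ x, Lift (f x) 1 := by
    intro x
    by_cases h : ∃ i, A i u ≠ 0 ∧ Cn S A x i
    · simp only [f, F, dif_pos h]
      exact hq1 _ h.choose_spec.1
    · simp only [f, F, dif_neg h]
      exact lift_one
  have hfn : ∀ x, f x ≠ 0 := fun x => (hf x).ne (by decide)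
  have hcon : ∀ x x', Cn S A x x' → f x = f x' := by
    intro x x' h
    simp only [f]
    congr 1
    funext i
    exact propext (and_congr_right fun _ => ⟨fun h' => h.symm.trans h', fun h' => h.trans h'⟩)
  refine ⟨f, fun y => if h : ∃ x, A x y ≠ 0 then (f h.choose)⁻¹ else 1, hf, ?_, ?_, ?_⟩
  · intro y
    by_cases h : ∃ x, A x y ≠ 0
    · simp only [dif_pos h]
      have := lift_inv (hf h.choose)
      rwa [InvOK.ok (1 : K) 1 (by decide)] at this
    · simp only [dif_neg h]
      exact lift_one
  · intro i hi
    have h : ∃ k, A k u ≠ 0 ∧ Cn S A i k := ⟨i, hi, Cn.refl i⟩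
    simp only [f, F, dif_pos h]
    exact (hq _ _ hi h.choose_spec.1 h.choose_spec.2).symm
  · intro x y hy hxy
    have h : ∃ x, A x y ≠ 0 := ⟨x, hxy⟩
    simp only [dif_pos h]
    rw [hcon x h.choose (Rel.cn ⟨y, hy, hxy, h.choose_spec⟩)]
    exact mul_inv_cancel₀ (hfn _)

/-- uniqueness up to scaling -/
theorem Un (hA : PM A) (S : Finset Y) : ∀ (_ : DLon (S : Set Y) A L1) (_ : DLon (S : Set Y) A L2),
    ∃ (f : X → ℚ) (g : Y → ℚ), (∀ x, Lift (f x) 1) ∧ (∀ y, Lift (g y) 1) ∧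
      ∀ x, ∀ y ∈ S, L2 x y = f x * L1 x y * g y := by
  classical
  induction S using Finset.induction_on with
  | empty => 
    intro _ _
    exact ⟨fun _ => 1, fun _ => 1, fun _ => lift_one, fun _ => lift_one, by simp⟩
  | insert u S hu ih =>
    intro h1 h2
    rw [Finset.coe_insert] at h1 h2
    obtain ⟨f, g, hf, hg, hfg⟩ := ih (h1.mono (Set.subset_insert _ _)) (h2.mono (Set.subset_insert _ _))
    have h1' := h1.scale1 hf hg
    have e1 : ∀ x, Lift (f x * L1 x u * g u) (A x u) := fun x => h1'.entry x (Set.mem_insert _ _)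
    have e2 : ∀ x, Lift (L2 x u) (A x u) := fun x => h2.entry x (Set.mem_insert _ _)
    obtain ⟨f', g', hf', hg', h3, h4⟩ := classScale (S := (S : Set Y)) (u := u) (A := A)
      (fun x => L2 x u * (f x * L1 x u * g u)⁻¹)
      (by
        intro x hx
        have := lift_mul (e2 x) (lift_inv (e1 x))
        rwa [(e2 x).inv hx] at this)
      (by
        intro i j hi hj hc
        have := Qlem hA (by simpa using hu) h1' h2 (fun x y hy => (hfg x y (by simpa using hy)).symm) hc
        simp only [Matrix.of_apply] at this
        have ni := (e1 i).ne hi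
        have nj := (e1 j).ne hj
        rw [← div_eq_mul_inv, ← div_eq_mul_inv, div_eq_div_iff ni nj]
        linarith)
    refine ⟨fun x => f' x * f x, fun y => g y * if y = u then 1 else g' y, ?_, ?_, ?_⟩
    · intro x; simpa using lift_mul (hf' x) (hf x)
    · intro y
      dsimp only
      split_ifs
      · simpa using hg y
      · simpa using lift_mul (hg y) (hg' y)
    · intro x y hy
      rw [Finset.mem_insert] at hy
      by_cases hyu : y = u
      · subst hyu
        by_cases hx : A x y = 0
        · have a1 := zero_of (h1.entry x (Set.mem_insert _ _)) hx
          have a2 := zero_of (e2 x) hx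
          simp [a1, a2]
        · have := (e1 x).ne hx
          simp only [if_true, h3 x hx]
          generalize L2 x y = b
          calc b = b * ((f x * L1 x y * g y)⁻¹ * (f x * L1 x y * g y)) := by
                rw [inv_mul_cancel₀ this, mul_one]
            _ = _ := by ring
      · have hyS : y ∈ S := by tauto
        simp only [if_neg hyu]
        rw [hfg x y hyS]
        by_cases hx : A x y = 0
        · have a1 := zero_of (h1.entry x (Set.mem_insert_of_mem _ hyS)) hx
          simp [a1]
        · have := h4 x y hyS hx
          linear_combination (- f x * L1 x y * g y) * this

def Hc (u v : Y) (A : Matrix X Y K) : Prop := ∀ i i' j j', A i u ≠ 0 → A i' v ≠ 0 →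
  Cn (off u v) A i i' → A j u ≠ 0 → A j' v ≠ 0 → Cn (off u v) A j j' → Cn (off u v) A i j

theorem N1 {x : X} {y : Y} (hy : y ∈ S) (h0 : A x y ≠ 0) {i : X} {w : Y}
    (h : piv A x y i w ≠ 0) : ∃ k, Cn S A i k ∧ A k w ≠ 0 := by
  by_cases hi : i = x <;> by_cases hw : w = y
  · subst hi hw; exact ⟨i, Cn.refl i, h0⟩
  · subst hi
    rw [piv_x A i y hw] at h
    exact ⟨i, Cn.refl i, fun h' => h (by rw [h', zero_mul])⟩
  · subst hw
    rw [piv_y A x w hi] at h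
    exact ⟨i, Cn.refl i, fun h' => h (by rw [h', zero_mul])⟩
  · rw [piv_o A x y hi hw] at h
    by_cases h1 : A i w = 0
    · by_cases h2 : A i y = 0
      · exact absurd (by rw [h1, h2]; ring) h
      · exact ⟨x, Rel.cn ⟨y, hy, h2, h0⟩, fun h' => h (by rw [h1, h']; ring)⟩
    · exact ⟨i, Cn.refl i, h1⟩

theorem Cn.of_piv {x : X} {y : Y} (hy : y ∈ S) (h0 : A x y ≠ 0) {i j : X}
    (h : Cn S (piv A x y) i j) : Cn S A i j := by
  induction h with
  | refl => exact Cn.refl _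
  | tail _ h ih =>
    obtain ⟨w, hw, a, b⟩ := h
    obtain ⟨k, hk, hk'⟩ := N1 hy h0 a
    obtain ⟨l, hl, hl'⟩ := N1 hy h0 b
    exact ih.trans (hk.trans ((Rel.cn ⟨w, hw, hk', hl'⟩).trans hl.symm))

theorem Cn.to_piv (hA : PM A) {x : X} {y : Y} (hy : y ∈ S) (h0 : A x y ≠ 0) {i j : X}
    (h : Cn S A i j) : Cn S (piv A x y) i j := by
  classical
  have hn : (piv A x y) x y ≠ 0 := by
    rw [piv_xy]
    exact neg_ne_zero.2 (U_inv_ne (hA.entry _ _) h0)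
  apply Cn.of_piv hy hn
  refine Relation.ReflTransGen.mono ?_ _ _ h
  have key := piv_piv A (hA.inv h0)
  rintro a b ⟨w, hw, ha, hb⟩
  refine ⟨w, hw, fun h' => ha ?_, fun h' => hb ?_⟩
  · rw [key]; simp [h']
  · rw [key]; simp [h']

theorem Hc.piv (hA : PM A) (h : Hc u v A) {x : X} {y : Y} (hy : y ∈ off u v) (h0 : A x y ≠ 0) :
    Hc u v (piv A x y) := by
  intro i i' j j' a1 a2 a3 a4 a5 a6
  obtain ⟨k1, c1, d1⟩ := N1 hy h0 a1
  obtain ⟨k2, c2, d2⟩ := N1 hy h0 a2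
  obtain ⟨k4, c4, d4⟩ := N1 hy h0 a4
  obtain ⟨k5, c5, d5⟩ := N1 hy h0 a5
  have := h k1 k2 k4 k5 d1 d2 (c1.symm.trans ((a3.of_piv hy h0).trans c2)) d4 d5
    (c4.symm.trans ((a6.of_piv hy h0).trans c5))
  exact (c1.trans (this.trans c4.symm)).to_piv hA hy h0

theorem comb [Finite Y] (hA : PM A) (huv : u ≠ v) (hH : Hc u v A) (h1 : DLon {u}ᶜ A L1)
    (h2 : DLon {v}ᶜ A L2) : ∃ L, DL A L := by
  classical
  have := Fintype.ofFinite Y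
  let S : Finset Y := Finset.univ.filter (fun y => y ≠ u ∧ y ≠ v)
  obtain ⟨f, g, hf, hg, hfg⟩ := Un hA S (L1 := L1) (L2 := L2)
    (h1.mono (by intro y hy; simp [S] at hy; exact hy.1))
    (h2.mono (by intro y hy; simp [S] at hy; exact hy.2))
  let L : Matrix X Y ℚ := Matrix.of fun x y => if y = u then L2 x u else f x * L1 x y * g y
  have good : Good u v A L := by
    refine ⟨huv, hA, (h1.scale1 hf hg).congr ?_, h2.congr ?_⟩
    · intro x y hy
      have : y ≠ u := hy
      simp [L, this]
    · intro x y hy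
      by_cases h : y = u
      · simp [L, h]
      · simp only [L, Matrix.of_apply, if_neg h]
        exact (hfg x y (by simp [S, h]; exact hy)).symm
  refine ⟨L, CL1 huv (fun A L => Good u v A L ∧ Hc u v A) ?_ ?_ A L ⟨good, hH⟩⟩
  · rintro A L ⟨h, hH⟩
    refine ⟨h.du, h.dv, fun i j => ?_⟩
    by_cases h0 : A i u = 0 ∨ A i v = 0 ∨ A j u = 0 ∨ A j v = 0
    · exact h.zero h0
    push Not at h0
    exact h.cn (hH i i j j h0.1 h0.2.1 (Cn.refl i) h0.2.2.1 h0.2.2.2 (Cn.refl j))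
  · rintro A L x y ⟨h, hH⟩ hu hv h0
    exact ⟨h.piv ⟨hu, hv⟩ h0, hH.piv h.pm ⟨hu, hv⟩ h0⟩

end
end Dyad

open Matrix
namespace Dyad

section
variable {X Y : Type*} {A : Matrix X Y K} {L L1 L2 : Matrix X Y ℚ} {S T : Set Y} {u v : Y}

theorem single {w : Y} (h : ∀ x, Lift (L x w) (A x w)) : DLon {w} A L := by
  intro n r c hc
  match n, r, c, hc with
  | 0, r, c, hc => simpa using lift_one
  | 1, r, c, hc =>
    rw [Matrix.det_fin_one, Matrix.det_fin_one, Matrix.submatrix_apply, Matrix.submatrix_apply, hc 0]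
    exact h _
  | n + 2, r, c, hc =>
    have h01 : (0 : Fin (n+2)) ≠ 1 := by simp
    rw [Matrix.det_zero_of_column_eq h01, Matrix.det_zero_of_column_eq h01]
    · exact lift_zero
    · intro k; simp only [Matrix.submatrix_apply]; rw [hc 0, hc 1]
    · intro k; simp only [Matrix.submatrix_apply]; rw [hc 0, hc 1]

theorem ex_single (hA : PM A) (w : Y) (h : ∀ y, y = w) : ∃ L, DL A L := by
  choose ℓ hℓ using fun x => lift_ex (hA.entry x w)
  refine ⟨Matrix.of fun x _ => ℓ x, DLon.dl ?_⟩
  have := single (A := A) (L := Matrix.of fun x _ => ℓ x) (w := w) hℓ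
  exact this.mono (fun y _ => h y)

theorem drop (h : ∃ L, DL (A.submatrix id (Subtype.val : {y // y ≠ u} → Y)) L) :
    ∃ L, DLon {u}ᶜ A L := by
  classical
  obtain ⟨L, hL⟩ := h
  refine ⟨Matrix.of fun x y => if h : y ≠ u then L x ⟨y, h⟩ else 0, ?_⟩
  intro n r c hc
  convert hL n r (fun i => ⟨c i, hc i⟩) using 2
  · ext i j
    have : c j ≠ u := hc j
    simp [this]
  · rfl

theorem ex_two (hA : PM A) (huv : u ≠ v) (h : ∀ y, y = u ∨ y = v) : ∃ L, DL A L := by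
  classical
  choose ℓ hℓ using fun x => lift_ex (hA.entry x u)
  -- it is enough to choose the second column
  suffices hs : ∃ t : X → ℚ, (∀ x, Lift (t x) (A x v)) ∧ ∀ i j, A i u ≠ 0 → A i v ≠ 0 → A j u ≠ 0 →
      A j v ≠ 0 → Lift (ℓ i * t j - t i * ℓ j) (A i u * A j v - A i v * A j u) by
    obtain ⟨t, ht, ht2⟩ := hs
    let L : Matrix X Y ℚ := Matrix.of fun x y => if y = u then ℓ x else t x
    have good : Good u v A L := by
      refine ⟨huv, hA, ?_, ?_⟩
      · refine (single (w := v) ?_).mono ?_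
        · intro x; simpa [L, huv.symm] using ht x
        · intro y hy; exact (h y).resolve_left hy
      · refine (single (w := u) ?_).mono ?_
        · intro x; simpa [L] using hℓ x
        · intro y hy; exact (h y).resolve_right hy
    refine ⟨L, CL1 huv (fun A' L' => A' = A ∧ L' = L) ?_ ?_ A L ⟨rfl, rfl⟩⟩
    · rintro A' L' ⟨hA', hL'⟩
      rw [hA', hL']
      refine ⟨good.du, good.dv, fun i j => ?_⟩
      by_cases h0 : A i u = 0 ∨ A i v = 0 ∨ A j u = 0 ∨ A j v = 0
      · exact good.zero h0
      push Not at h0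
      simpa [L, huv.symm] using ht2 i j h0.1 h0.2.1 h0.2.2.1 h0.2.2.2
    · rintro _ _ x y ⟨rfl, rfl⟩ hu hv
      rcases h y with h | h
      · exact absurd h hu
      · exact absurd h hv
  choose m hm using fun x => lift_ex (hA.entry x v)
  by_cases hb : ∃ b, A b u ≠ 0 ∧ A b v ≠ 0
  swap
  · push Not at hb
    exact ⟨m, hm, fun i j h1 h2 => absurd (hb i h1) h2⟩
  obtain ⟨b, hbu, hbv⟩ := hb
  have key : ∀ x, ∃ t, Lift t (A x v) ∧ (A x u ≠ 0 → A x v ≠ 0 →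
      Lift (ℓ x * m b - t * ℓ b) (A x u * A b v - A x v * A b u)) := by
    intro x
    by_cases h1 : A x u ≠ 0 ∧ A x v ≠ 0
    swap
    · exact ⟨m x, hm x, fun a b => absurd ⟨a, b⟩ h1⟩
    obtain ⟨h1, h2⟩ := h1
    have e := hA.entry
    obtain ⟨hU, hI⟩ := U_ratio (e x v) (e b u) h2 hbu (hA.minor2 x b u v)
    obtain ⟨p, hp, hpl⟩ := F1_ex (ne_zero_mul (U_mul (e _ _) (e _ _)) (U_inv (U_mul (e _ _) (e _ _)))
      (ne_zero_mul (e _ _) (e _ _) h1 hbv) (U_inv_ne (U_mul (e _ _) (e _ _))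
        (ne_zero_mul (e _ _) (e _ _) h2 hbu)))
      (U_mul (U_mul (e _ _) (e _ _)) (U_inv (U_mul (e _ _) (e _ _)))) hU
    have p0 : p ≠ 0 := by rcases hp with rfl | rfl | rfl | rfl <;> norm_num
    have a1 := (hℓ x).ne h1
    have a2 := (hℓ b).ne hbu
    have a3 := (hm b).ne hbv
    have l1 : Lift (ℓ x * m b * (p * ℓ b)⁻¹) (A x v) := by
      convert lift_mul (lift_mul (hℓ x) (hm b)) (lift_inv (lift_mul hpl (hℓ b))) using 1
      have k1 := (hℓ x).inv h1
      have k2 := (hℓ b).inv hbu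
      have k3 := (hm b).inv hbv
      have k4 := (hm x).inv h2
      rw [InvOK.ok _ (A x v * A b u * (A x u)⁻¹ * (A b v)⁻¹ * (A b u)⁻¹)]
      · linear_combination (- A x v) * (k1 + A x u * (A x u)⁻¹ * (k3 + A b v * (A b v)⁻¹ * k2))
      · rw [mul_inv]
        linear_combination k1 + (A x u * (A x u)⁻¹) * (k3 + A b v * (A b v)⁻¹ *
          (k2 + A b u * (A b u)⁻¹ * (k4 + A x v * (A x v)⁻¹ * k2)))
    refine ⟨_, l1, fun _ _ => ?_⟩
    apply minor_of_F1 (hℓ x) l1 (hℓ b) (hm b) h2 hbu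
    convert hp using 1
    field_simp
  choose t ht ht2 using key
  refine ⟨t, ht, fun i j h1 h2 h3 h4 => ?_⟩
  have := minor_comp (hℓ i) (hℓ j) (ht i) (ht j) (hℓ b) (hm b) h1 h3 h2 h4 hbu hbv
      (w1 := A i u * A b v - A i v * A b u) (w2 := - (A j u * A b v - A j v * A b u))
      (by convert ht2 i h1 h2 using 1; ring) (by convert lift_neg (ht2 j h3 h4) using 1; ring)
      (by convert hA.minor2 i j u v using 1; ring)
  convert this using 1 <;> ring

theorem conn_del {V : Type*} (F : SimpleGraph V) (p : X → V) (q : Y → V) (hp : Function.Injective p)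
    (hcov : ∀ w, (∃ x, w = p x) ∨ ∃ y, w = q y) (hdis : ∀ x y, p x ≠ q y)
    (hpq : ∀ x y, F.Adj (p x) (q y) → A x y ≠ 0)
    (hpp : ∀ x x', ¬ F.Adj (p x) (p x')) (hqq : ∀ x x', ¬ F.Adj (q x) (q x'))
    (hF : F.Preconnected) (lu : (F.neighborSet (q u)).Subsingleton)
    (lv : (F.neighborSet (q v)).Subsingleton) (i j : X) : Cn (off u v) A i j := by
  have h1 := SimpleGraph.Preconnected.induce_of_degree_eq_one hF (s := {w | w ≠ q u ∧ w ≠ q v}) (by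
    intro w hw
    simp only [Set.mem_ofPred_eq, not_and_or, not_not] at hw
    rcases hw with rfl | rfl
    · exact lu
    · exact lv)
  have h2 := h1 ⟨p i, hdis _ _, hdis _ _⟩ ⟨p j, hdis _ _, hdis _ _⟩
  rw [SimpleGraph.reachable_iff_reflTransGen] at h2
  have key : ∀ w, Relation.ReflTransGen
      (F.induce {w | w ≠ q u ∧ w ≠ q v}).Adj ⟨p i, hdis _ _, hdis _ _⟩ w →
      (∃ x, w.1 = p x ∧ Cn (off u v) A i x) ∨
      (∃ y x, w.1 = q y ∧ Cn (off u v) A i x ∧ A x y ≠ 0) := by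
    intro w hw
    induction hw with
    | refl => exact Or.inl ⟨i, rfl, Cn.refl i⟩
    | @tail b c _ hbc ih =>
      have hbc : F.Adj b.1 c.1 := hbc
      rcases ih with ⟨x, hx, hc⟩ | ⟨y, x, hx, hc, hne⟩
      · rcases hcov c.1 with ⟨x', hx'⟩ | ⟨y, hy⟩
        · rw [hx, hx'] at hbc
          exact absurd hbc (hpp _ _)
        · rw [hx, hy] at hbc
          exact Or.inr ⟨y, x, hy, hc, hpq _ _ hbc⟩
      · rcases hcov c.1 with ⟨x', hx'⟩ | ⟨y', hy⟩
        · rw [hx, hx'] at hbc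
          refine Or.inl ⟨x', hx', hc.trans (Rel.cn ⟨y, ⟨?_, ?_⟩, hne, hpq _ _ hbc.symm⟩)⟩
          · rintro rfl; exact b.2.1 hx
          · rintro rfl; exact b.2.2 hx
        · rw [hx, hy] at hbc
          exact absurd hbc (hqq _ _)
  rcases key _ h2 with ⟨x, hx, hc⟩ | ⟨y, x, hx, -⟩
  · rwa [hp hx]
  · exact absurd hx (hdis _ _)

end
end Dyad

open Matrix
namespace Dyad

theorem three_leaves {V : Type*} [Fintype V] (G : SimpleGraph V) (hG : G.Connected) {c a1 a2 a3 : V}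
    (h12 : a1 ≠ a2) (h13 : a1 ≠ a3) (h23 : a2 ≠ a3) (h1 : G.Adj c a1) (h2 : G.Adj c a2)
    (h3 : G.Adj c a3) : ∃ F ≤ G, F.Connected ∧ ∃ l1 l2 l3 : V, l1 ≠ l2 ∧ l1 ≠ l3 ∧ l2 ≠ l3 ∧
      (F.neighborSet l1).Subsingleton ∧ (F.neighborSet l2).Subsingleton ∧
      (F.neighborSet l3).Subsingleton := by
  classical
  obtain ⟨F, hHF, hFG, hF⟩ := hG.exists_isTree_le_of_le_of_isAcyclic
    (H := SimpleGraph.starGraph c ⊓ G) inf_le_right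
    ((SimpleGraph.isAcyclic_starGraph c).anti inf_le_left)
  refine ⟨F, hFG, hF.1, ?_⟩
  have adj : ∀ a, G.Adj c a → F.Adj c a := by
    intro a ha
    apply hHF
    rw [SimpleGraph.inf_adj, SimpleGraph.starGraph_adj]
    exact ⟨⟨ha.ne, Or.inl rfl⟩, ha⟩
  have : Nontrivial V := ⟨a1, a2, h12⟩
  have hc : 3 ≤ F.degree c := by
    rw [← SimpleGraph.card_neighborFinset_eq_degree]
    have : ({a1, a2, a3} : Finset V) ⊆ F.neighborFinset c := by
      intro a ha
      simp only [Finset.mem_insert, Finset.mem_singleton] at ha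
      rw [SimpleGraph.mem_neighborFinset]
      rcases ha with rfl | rfl | rfl
      · exact adj _ h1
      · exact adj _ h2
      · exact adj _ h3
    calc 3 = ({a1, a2, a3} : Finset V).card := by rw [Finset.card_eq_three.2 ⟨a1, a2, a3, h12, h13, h23, rfl⟩]
      _ ≤ _ := Finset.card_le_card this
  have e1 := hF.card_edgeFinset
  have e2 := F.sum_degrees_eq_twice_card_edges
  let Lf : Finset V := Finset.univ.filter fun v => F.degree v ≤ 1
  have hle : ∑ v : V, (2 + if v = c then 1 else 0) ≤ ∑ v : V, (F.degree v + if F.degree v ≤ 1 then 1 else 0) := by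
    apply Finset.sum_le_sum
    intro v _
    have := hF.1.preconnected.degree_pos_of_nontrivial v
    by_cases hv : v = c
    · subst hv; simp; omega
    · simp only [hv, if_false]
      split_ifs <;> omega
  rw [Finset.sum_add_distrib, Finset.sum_add_distrib, e2] at hle
  simp only [Finset.sum_const, Finset.card_univ, Finset.sum_ite_eq', Finset.mem_univ, if_true, smul_eq_mul] at hle
  have h3 : 2 < Lf.card := by
    simp only [Lf]
    rw [Finset.card_filter]
    omega
  obtain ⟨l1, m1, l2, m2, l3, m3, n12, n13, n23⟩ := Finset.two_lt_card.1 h3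
  have sub : ∀ l ∈ Lf, (F.neighborSet l).Subsingleton := by
    intro l hl a ha b hb
    simp only [Lf, Finset.mem_filter, Finset.mem_univ, true_and] at hl
    rw [← SimpleGraph.card_neighborFinset_eq_degree, Finset.card_le_one] at hl
    exact hl a (by simpa using ha) b (by simpa using hb)
  exact ⟨l1, l2, l3, n12, n13, n23, sub _ m1, sub _ m2, sub _ m3⟩

section
variable {X Y : Type*} {A : Matrix X Y K} {L L1 L2 : Matrix X Y ℚ} {S T : Set Y} {u v : Y}

def bg (A : Matrix X Y K) : SimpleGraph (X ⊕ Y) where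
  Adj a b := (∃ x y, a = .inl x ∧ b = .inr y ∧ A x y ≠ 0) ∨ (∃ x y, b = .inl x ∧ a = .inr y ∧ A x y ≠ 0)
  symm := ⟨fun a b h => h.symm⟩
  loopless := ⟨by
    rintro a (⟨x, y, h1, h2, -⟩ | ⟨x, y, h1, h2, -⟩) <;> rw [h1] at h2 <;> cases h2⟩

theorem bg_adj {x y} : (bg A).Adj (.inl x) (.inr y) ↔ A x y ≠ 0 := by
  simp [bg]
theorem bg_adj' {x y} : (bg A).Adj (.inr y) (.inl x) ↔ A x y ≠ 0 := by
  simp [bg]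
theorem bg_adj1 {x x'} : ¬ (bg A).Adj (.inl x) (.inl x') := by
  simp [bg]
theorem bg_adj2 {x x'} : ¬ (bg A).Adj (.inr x) (.inr x') := by
  simp [bg]

theorem bg_conn [Nonempty X] (hc : ∀ a b, Cn Set.univ A a b) (hy : ∀ y, ∃ x, A x y ≠ 0) :
    (bg A).Connected := by
  have h1 : ∀ a b, (bg A).Reachable (.inl a) (.inl b) := by
    intro a b
    have := hc a b
    induction this with
    | refl => exact SimpleGraph.Reachable.refl _
    | tail _ h ih =>
      obtain ⟨y, -, h1, h2⟩ := h
      exact ih.trans ((bg_adj.2 h1).reachable.trans (bg_adj'.2 h2).reachable)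
  have h2 : ∀ w, ∃ a, (bg A).Reachable w (.inl a) := by
    rintro (a | y)
    · exact ⟨a, SimpleGraph.Reachable.refl _⟩
    · obtain ⟨x, hx⟩ := hy y
      exact ⟨x, (bg_adj'.2 hx).reachable⟩
  have : Nonempty (X ⊕ Y) := ⟨.inl (Classical.arbitrary X)⟩
  refine SimpleGraph.Connected.mk ?_
  intro w w'
  obtain ⟨a, ha⟩ := h2 w
  obtain ⟨b, hb⟩ := h2 w'
  exact ha.trans ((h1 a b).trans hb.symm)

theorem B4 [Finite X] [Finite Y] [Nonempty X] (hc : ∀ a b, Cn Set.univ A a b)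
    (hy : ∀ y, ∃ x, A x y ≠ 0) {c a1 a2 a3 : X ⊕ Y}
    (h12 : a1 ≠ a2) (h13 : a1 ≠ a3) (h23 : a2 ≠ a3) (h1 : (bg A).Adj c a1) (h2 : (bg A).Adj c a2)
    (h3 : (bg A).Adj c a3) (k1 : ∀ u v, u ≠ v → ¬ Hc u v A) (k2 : ∀ u v, u ≠ v → ¬ Hc u v Aᵀ) : False := by
  classical
  have := Fintype.ofFinite X
  have := Fintype.ofFinite Y
  obtain ⟨F, hFG, hF, l1, l2, l3, n12, n13, n23, s1, s2, s3⟩ :=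
    three_leaves (bg A) (bg_conn hc hy) h12 h13 h23 h1 h2 h3
  have cY : ∀ u v : Y, u ≠ v → (F.neighborSet (.inr u)).Subsingleton →
      (F.neighborSet (.inr v)).Subsingleton → False := by
    intro u v huv su sv
    apply k1 u v huv
    intro i _ j _ _ _ _ _ _ _
    exact conn_del F Sum.inl Sum.inr Sum.inl_injective (by rintro (x | y); exacts [Or.inl ⟨x, rfl⟩, Or.inr ⟨y, rfl⟩])
      (by simp) (fun x y h => bg_adj.1 (hFG h)) (fun x y h => bg_adj1 (hFG h)) (fun x y h => bg_adj2 (hFG h))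
      hF.preconnected su sv i j
  have cX : ∀ u v : X, u ≠ v → (F.neighborSet (.inl u)).Subsingleton →
      (F.neighborSet (.inl v)).Subsingleton → False := by
    intro u v huv su sv
    apply k2 u v huv
    intro i _ j _ _ _ _ _ _ _
    exact conn_del F Sum.inr Sum.inl Sum.inr_injective (by rintro (x | y); exacts [Or.inr ⟨x, rfl⟩, Or.inl ⟨y, rfl⟩])
      (by simp) (fun x y h => bg_adj'.1 (hFG h)) (fun x y h => bg_adj2 (hFG h)) (fun x y h => bg_adj1 (hFG h))
      hF.preconnected su sv i j
  rcases l1 with l1 | l1 <;> rcases l2 with l2 | l2 <;> rcases l3 with l3 | l3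
  · exact cX l1 l2 (by simpa using n12) s1 s2
  · exact cX l1 l2 (by simpa using n12) s1 s2
  · exact cX l1 l3 (by simpa using n13) s1 s3
  · exact cY l2 l3 (by simpa using n23) s2 s3
  · exact cX l2 l3 (by simpa using n23) s2 s3
  · exact cY l1 l3 (by simpa using n13) s1 s3
  · exact cY l1 l2 (by simpa using n12) s1 s2
  · exact cY l1 l2 (by simpa using n12) s1 s2

theorem B2 [Nontrivial Y] (k1 : ∀ u v, u ≠ v → ¬ Hc u v A) (u : Y) :
    ∃ x x', x ≠ x' ∧ A x u ≠ 0 ∧ A x' u ≠ 0 := by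
  by_contra hcon
  push Not at hcon
  obtain ⟨v, hv⟩ := exists_ne u
  apply k1 u v hv.symm
  intro i _ j _ hi _ _ hj _ _
  by_cases hij : i = j
  · subst hij; exact Cn.refl _
  · exact absurd (hcon i j hij hi) hj

theorem fin_core [Finite X] [Finite Y] (y1 y2 y3 : Y) (n12 : y1 ≠ y2) (n13 : y1 ≠ y3) (n23 : y2 ≠ y3)
    (hb : ∀ A : Matrix X Y K, PM A → (¬ ∃ L, DL A L) →
      (∀ u v, u ≠ v → ¬ Hc u v A) ∧ (∀ u v, u ≠ v → ¬ Hc u v Aᵀ)) (hA : PM A) : ∃ L, DL A L := by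
  classical
  have : Nontrivial Y := ⟨y1, y2, n12⟩
  -- structure of bad matrices
  have gen : ∀ A : Matrix X Y K, PM A → (¬ ∃ L, DL A L) → Nontrivial X ∧ (∀ a b, Cn Set.univ A a b) ∧
      (∀ y, ∃ x x', x ≠ x' ∧ A x y ≠ 0 ∧ A x' y ≠ 0) ∧ (∀ x, ∃ y y', y ≠ y' ∧ A x y ≠ 0 ∧ A x y' ≠ 0) ∧
      (∀ x a b c, a ≠ b → a ≠ c → b ≠ c → A x a ≠ 0 → A x b ≠ 0 → A x c = 0) ∧
      (∀ y a b c, a ≠ b → a ≠ c → b ≠ c → A a y ≠ 0 → A b y ≠ 0 → A c y = 0) := by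
    intro A hA hbad
    obtain ⟨k1, k2⟩ := hb A hA hbad
    have hX : Nontrivial X := by
      by_contra hX
      rw [not_nontrivial_iff_subsingleton] at hX
      apply k1 y1 y2 n12
      intro i _ j _ _ _ _ _ _ _
      rw [Subsingleton.elim i j]
      exact Cn.refl _
    have c2 := B2 k1
    have r2 := B2 (A := Aᵀ) k2
    have con : ∀ a b, Cn Set.univ A a b := by
      intro a b
      by_contra hab
      obtain ⟨u, u', huu, hu, hu'⟩ := r2 a
      obtain ⟨v, v', hvv, hv, hv'⟩ := r2 b
      simp only [Matrix.transpose_apply] at hu hu' hv hv'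
      obtain ⟨v, hv, huv⟩ : ∃ w, A b w ≠ 0 ∧ u ≠ w := by
        by_cases h : u = v
        · exact ⟨v', hv', h ▸ hvv⟩
        · exact ⟨v, hv, h⟩
      apply k1 u v huv
      intro i i' _ _ hi hi' hc _ _ _
      exfalso
      apply hab
      have e1 : Cn Set.univ A a i := Rel.cn ⟨u, trivial, hu, hi⟩
      have e2 : Cn Set.univ A i' b := Rel.cn ⟨v, trivial, hi', hv⟩
      have e3 : Cn Set.univ A i i' :=
        Relation.ReflTransGen.mono (fun p q ⟨y, _, h⟩ => ⟨y, trivial, h⟩) _ _ hc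
      exact e1.trans (e3.trans e2)
    have hy : ∀ y, ∃ x, A x y ≠ 0 := fun y => let ⟨x, _, _, h, _⟩ := c2 y; ⟨x, h⟩
    refine ⟨hX, con, c2, r2, ?_, ?_⟩
    · intro x a b c h1 h2 h3 ha hb
      by_contra hc
      exact B4 con hy (c := .inl x) (a1 := .inr a) (a2 := .inr b) (a3 := .inr c) (by simpa using h1)
        (by simpa using h2) (by simpa using h3) (bg_adj.2 ha) (bg_adj.2 hb) (bg_adj.2 hc) k1 k2
    · intro x a b c h1 h2 h3 ha hb
      by_contra hc
      exact B4 con hy (c := .inr x) (a1 := .inl a) (a2 := .inl b) (a3 := .inl c) (by simpa using h1)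
        (by simpa using h2) (by simpa using h3) (bg_adj'.2 ha) (bg_adj'.2 hb) (bg_adj'.2 hc) k1 k2
  by_contra hbad
  obtain ⟨hX, con, c2, r2, rt, ct⟩ := gen A hA hbad
  obtain ⟨x, x1, hxx, hx, hx1⟩ := c2 y1
  have oth : ∀ x, ∃ y, y ≠ y1 ∧ A x y ≠ 0 := by
    intro x
    obtain ⟨y, y', h, h1, h2⟩ := r2 x
    by_cases hy : y = y1
    · exact ⟨y', fun h' => h (hy.trans h'.symm), h2⟩
    · exact ⟨y, hy, h1⟩
  obtain ⟨p, hp1, hp⟩ := oth x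
  obtain ⟨q, hq1, hq⟩ := oth x1
  by_cases h0 : A x1 p = 0
  · have hpq : p ≠ q := by rintro rfl; exact hq h0
    obtain ⟨-, -, -, -, rt', -⟩ := gen (piv A x y1) (hA.piv hx) (fun ⟨L, hL⟩ => hbad (hL.unpiv hA hx))
    have e := hA.entry
    have hi := U_inv_ne (e x y1) hx
    have z : A x q = 0 := rt x y1 p q hp1.symm hq1.symm hpq hx hp
    refine hq ?_
    have := rt' x1 y1 p q hp1.symm hq1.symm hpq ?_ ?_
    · rw [piv_o _ _ _ hxx.symm hq1, z] at this
      simpa using this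
    · rw [piv_y _ _ _ hxx.symm]
      exact ne_zero_mul (e _ _) (U_inv (e _ _)) hx1 hi
    · rw [piv_o _ _ _ hxx.symm hp1, h0, zero_sub, neg_ne_zero]
      exact ne_zero_mul (U_mul (e _ _) (e _ _)) (U_inv (e _ _)) (ne_zero_mul (e _ _) (e _ _) hx1 hp) hi
  · have rows : ∀ z, (z = x ∨ z = x1) → ∀ w, A z w ≠ 0 → w = y1 ∨ w = p := by
      intro z hz w hw
      by_contra hcon
      push Not at hcon
      rcases hz with rfl | rfl
      · exact hw (rt z y1 p w hp1.symm hcon.1.symm hcon.2.symm hx hp)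
      · exact hw (rt z y1 p w hp1.symm hcon.1.symm hcon.2.symm hx1 h0)
    have cols : ∀ w, (w = y1 ∨ w = p) → ∀ z, A z w ≠ 0 → z = x ∨ z = x1 := by
      intro w hw z hz
      by_contra hcon
      push Not at hcon
      rcases hw with rfl | rfl
      · exact hz (ct w x x1 z hxx hcon.1.symm hcon.2.symm hx hx1)
      · exact hz (ct w x x1 z hxx hcon.1.symm hcon.2.symm hp h0)
    have cl : ∀ z, Cn Set.univ A x z → z = x ∨ z = x1 := by
      intro z hz
      induction hz with
      | refl => exact Or.inl rfl
      | tail _ h ih =>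
        obtain ⟨y, -, h1, h2⟩ := h
        exact cols _ (rows _ ih _ h1) _ h2
    have all : ∀ w, w = y1 ∨ w = p := by
      intro w
      obtain ⟨z, _, _, hz, _⟩ := c2 w
      exact rows z (cl z (con x z)) w hz
    rcases all y2 with h | h
    · exact n12 h.symm
    · rcases all y3 with h' | h'
      · exact n13 h'.symm
      · exact n23 (h.trans h'.symm)

end

theorem fin_ex : ∀ (N : ℕ) (X Y : Type u) [Fintype X] [Fintype Y] (A : Matrix X Y K),
    Fintype.card X + Fintype.card Y ≤ N → PM A → ∃ L, DL A L := by
  intro N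
  induction N with
  | zero =>
    intro X Y _ _ A hN hA
    have : IsEmpty Y := Fintype.card_eq_zero_iff.1 (by omega)
    exact ⟨0, by
      intro n r c
      match n, r, c with
      | 0, r, c => simpa using lift_one
      | n + 1, r, c => exact (this.false (c 0)).elim⟩
  | succ N ih =>
    intro X Y _ _ A hN hA
    classical
    have del : ∀ (X Y : Type u) [Fintype X] [Fintype Y] (A : Matrix X Y K),
        Fintype.card X + Fintype.card Y ≤ N + 1 → PM A → (¬ ∃ L, DL A L) →
        ∀ u v, u ≠ v → ¬ Hc u v A := by
      intro X Y _ _ A hN hA hbad u v huv hH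
      have d : ∀ u, ∃ L, DLon {u}ᶜ A L := by
        intro u
        apply drop
        apply ih X {y // y ≠ u} _ _ (hA.sub _ _)
        have := Fintype.card_subtype_lt (p := fun y => y ≠ u) (x := u) (by simp)
        omega
      obtain ⟨L1, h1⟩ := d u
      obtain ⟨L2, h2⟩ := d v
      exact hbad (comb hA huv hH h1 h2)
    rcases isEmpty_or_nonempty Y with hY | ⟨⟨y1⟩⟩
    · exact ⟨0, by
        intro n r c
        match n, r, c with
        | 0, r, c => simpa using lift_one
        | n + 1, r, c => exact (hY.false (c 0)).elim⟩
    by_cases h1 : ∀ y, y = y1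
    · exact ex_single hA y1 h1
    push Not at h1
    obtain ⟨y2, h12⟩ := h1
    by_cases h2 : ∀ y, y = y1 ∨ y = y2
    · exact ex_two hA h12.symm h2
    push Not at h2
    obtain ⟨y3, h13, h23⟩ := h2
    refine fin_core y1 y2 y3 h12.symm h13.symm h23.symm ?_ hA
    intro A hA hbad
    refine ⟨del X Y A hN hA hbad, del Y X Aᵀ (by omega) hA.tr ?_⟩
    rintro ⟨L, hL⟩
    exact hbad ⟨Lᵀ, hL.tr⟩

theorem fin_ex' {X Y : Type u} [Finite X] [Finite Y] {A : Matrix X Y K} (hA : PM A) : ∃ L, DL A L := by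
  have := Fintype.ofFinite X
  have := Fintype.ofFinite Y
  exact fin_ex _ X Y A le_rfl hA

end Dyad

open Matrix
namespace Dyad
universe u
section
variable {X Y : Type u} {A : Matrix X Y K} {L L1 L2 : Matrix X Y ℚ} {S T : Set Y} {u v : Y}

open Classical in
noncomputable def upd (L : Matrix X Y ℚ) (u : Y) (s : X → ℚ) : Matrix X Y ℚ :=
  Matrix.of fun x y => if y = u then s x else L x y

theorem upd_self (L : Matrix X Y ℚ) (u : Y) (s : X → ℚ) (x : X) : upd L u s x u = s x := by simp [upd]
theorem upd_ne (L : Matrix X Y ℚ) {u : Y} (s : X → ℚ) (x : X) {y : Y} (h : y ≠ u) :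
    upd L u s x y = L x y := by simp [upd, h]

/-- `s` solves the extension problem on the rows in `R` and the columns in `C`. -/
def D (A : Matrix X Y K) (L : Matrix X Y ℚ) (u : Y) (R : Finset X) (C : Finset Y) (s : X → ℚ) : Prop :=
  DLon (insert u (C : Set Y)) (A.submatrix (Subtype.val : R → X) id)
    ((upd L u s).submatrix (Subtype.val : R → X) id)

theorem D.mono {R R' : Finset X} {C C' : Finset Y} {s : X → ℚ} (h : D A L u R' C' s) (hR : R ⊆ R')
    (hC : C ⊆ C') : D A L u R C s := by
  intro n r c hc
  exact h n (fun i => ⟨r i, hR (r i).2⟩) c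
    (fun i => (hc i).imp id (fun h => Finset.coe_subset.2 hC h))

theorem D.lift {R : Finset X} {C : Finset Y} {s : X → ℚ} (h : D A L u R C s) {x : X} (hx : x ∈ R) :
    Lift (s x) (A x u) := by
  have := DLon.entry h ⟨x, hx⟩ (y := u) (Set.mem_insert _ _)
  simpa [upd] using this

theorem D.ex (hA : PM A) (hu : u ∉ S) (hL : DLon S A L) (R : Finset X) (C : Finset Y)
    (hC : (C : Set Y) ⊆ S) : ∃ s, D A L u R C s := by
  classical
  obtain ⟨L0, h0⟩ := fin_ex' (hA.sub (Subtype.val : R → X)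
    (Subtype.val : {y // y ∈ insert u C} → Y))
  let L1 : Matrix R Y ℚ := Matrix.of fun x y => if h : y ∈ insert u C then L0 x ⟨y, h⟩ else 0
  have h1 : DLon (insert u (C : Set Y)) (A.submatrix (Subtype.val : R → X) id) L1 := by
    intro n r c hc
    have hc' : ∀ i, c i ∈ insert u C := by simpa using hc
    convert h0 n r (fun i => ⟨c i, hc' i⟩) using 2
    · ext i j
      simp only [Matrix.submatrix_apply, L1, Matrix.of_apply]
      rw [dif_pos (hc' j)]
    · rfl
  obtain ⟨f, g, hf, hg, hfg⟩ := Un (hA.sub (Subtype.val : R → X) id) C (L1 := L1)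
    (L2 := L.submatrix Subtype.val id) (h1.mono (Set.subset_insert _ _))
    (hL.sub _ _ (fun y hy => hC hy))
  refine ⟨fun x => if h : x ∈ R then f ⟨x, h⟩ * L1 ⟨x, h⟩ u * g u else 0, ?_⟩
  refine (h1.scale1 hf hg).congr ?_
  rintro x y (rfl | hy)
  · simp [upd]
  · have hyu : y ≠ u := by rintro rfl; exact hu (hC hy)
    have := hfg x y hy
    simp only [Matrix.submatrix_apply, id] at this ⊢
    rw [upd_ne _ _ _ hyu, this]
    try rfl

/-- A path is witnessed by a finite submatrix. -/
theorem Cn.loc {i j : X} (h : Cn S A i j) : ∃ (R : Finset X) (C : Finset Y), (C : Set Y) ⊆ S ∧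
    ∀ R' C', R ⊆ R' → C ⊆ C' → ∃ (hi : i ∈ R') (hj : j ∈ R'),
      Cn (C' : Set Y) (A.submatrix (Subtype.val : {x // x ∈ R'} → X) id) ⟨i, hi⟩ ⟨j, hj⟩ := by
  classical
  induction h with
  | refl => exact ⟨{i}, ∅, by simp, fun R' C' hR _ => ⟨hR (by simp), hR (by simp), Cn.refl _⟩⟩
  | @tail b c _ h ih =>
    obtain ⟨R, C, hC, hh⟩ := ih
    obtain ⟨y, hy, h1, h2⟩ := h
    refine ⟨insert c R, insert y C, ?_, fun R' C' hR hC => ?_⟩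
    · rw [Finset.coe_insert]; exact Set.insert_subset hy hC
    · obtain ⟨hi, hj, hc⟩ := hh R' C' ((Finset.subset_insert _ _).trans hR)
        ((Finset.subset_insert _ _).trans hC)
      exact ⟨hi, hR (by simp), hc.trans (Rel.cn ⟨y, hC (by simp), h1, h2⟩)⟩

theorem D.ratio (hA : PM A) {R : Finset X} {C : Finset Y} {s s' : X → ℚ} (huC : u ∉ C)
    (h : D A L u R C s) (h' : D A L u R C s') {i j : X} (hi : i ∈ R) (hj : j ∈ R)
    (hc : Cn (C : Set Y) (A.submatrix (Subtype.val : {x // x ∈ R} → X) id) ⟨i, hi⟩ ⟨j, hj⟩) :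
    s i * s' j = s' i * s j := by
  have := Qlem (hA.sub _ _) (u := u) (S := (C : Set Y)) huC h h' (by
    intro x y hy
    have : y ≠ u := by rintro rfl; exact huC hy
    simp only [Matrix.submatrix_apply, id]
    rw [upd_ne _ _ _ this, upd_ne _ _ _ this]) hc
  simpa [upd] using this

theorem extend (hA : PM A) (hu : u ∉ S) (hL : DLon S A L) :
    ∃ c, DLon (insert u S) A (upd L u c) := by
  classical
  rcases isEmpty_or_nonempty X with hX | hX
  · exact ⟨fun _ => 0, by
      intro n r c _
      match n, r, c with
      | 0, r, c => simpa using lift_one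
      | n + 1, r, c => exact (hX.false (r 0)).elim⟩
  choose β hβ using fun x => lift_ex (hA.entry x u)
  let Q : X → X → Prop := fun i j => A j u ≠ 0 ∧ Cn S A i j
  let ρ : X → X := fun i => Classical.epsilon (Q i)
  have hρ : ∀ i, A i u ≠ 0 → A (ρ i) u ≠ 0 ∧ Cn S A i (ρ i) := fun i hi =>
    Classical.epsilon_spec (p := Q i) ⟨i, hi, Cn.refl i⟩
  have hρe : ∀ i j, Cn S A i j → ρ i = ρ j := by
    intro i j h
    have : Q i = Q j := by
      funext k
      exact propext ⟨fun ⟨a, b⟩ => ⟨a, h.symm.trans b⟩, fun ⟨a, b⟩ => ⟨a, h.trans b⟩⟩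
    simp only [ρ, this]
  have loc : ∀ i, ∃ (R : Finset X) (C : Finset Y), (C : Set Y) ⊆ S ∧ (A i u ≠ 0 → 
      ∀ R' C', R ⊆ R' → C ⊆ C' → ∃ (hi : i ∈ R') (hj : ρ i ∈ R'),
        Cn (C' : Set Y) (A.submatrix (Subtype.val : {x // x ∈ R'} → X) id) ⟨i, hi⟩ ⟨ρ i, hj⟩) := by
    intro i
    by_cases hi : A i u ≠ 0
    · obtain ⟨R, C, h1, h2⟩ := (hρ i hi).2.loc
      exact ⟨R, C, h1, fun _ => h2⟩
    · exact ⟨∅, ∅, by simp, fun h => absurd h hi⟩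
  choose Rf Cf hCf hloc using loc
  choose sf hsf using fun i => D.ex hA hu hL (Rf i) (Cf i) (hCf i)
  let c : X → ℚ := fun i => if A i u = 0 then 0 else sf i i / sf i (ρ i) * β (ρ i)
  have key : ∀ (R : Finset X) (C : Finset Y), (C : Set Y) ⊆ S → D A L u R C c := by
    intro R C hC
    let R' := R ∪ R.biUnion Rf
    let C' := C ∪ R.biUnion Cf
    have hC' : (C' : Set Y) ⊆ S := by
      simp only [C', Finset.coe_union, Finset.coe_biUnion]
      exact Set.union_subset hC (Set.iUnion₂_subset fun i _ => hCf i)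
    obtain ⟨s, hs⟩ := D.ex hA hu hL R' C' hC'
    have sub1 : ∀ i ∈ R, Rf i ⊆ R' := fun i hi =>
      (Finset.subset_biUnion_of_mem Rf hi).trans Finset.subset_union_right
    have sub2 : ∀ i ∈ R, Cf i ⊆ C' := fun i hi =>
      (Finset.subset_biUnion_of_mem Cf hi).trans Finset.subset_union_right
    have hsR : D A L u R C s := hs.mono Finset.subset_union_left Finset.subset_union_left
    have hrat : ∀ i ∈ R, A i u ≠ 0 → Lift (s (ρ i)) (A (ρ i) u) ∧
        c i = s i * (β (ρ i) / s (ρ i)) := by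
      intro i hi h0
      obtain ⟨m1, m2, hc⟩ := hloc i h0 _ _ subset_rfl subset_rfl
      have hsi := hs.mono (sub1 i hi) (sub2 i hi)
      have e := D.ratio hA (fun h => hu (hCf i h)) (hsf i) hsi m1 m2 hc
      have l1 := hsi.lift m2
      have l2 := (hsf i).lift m2
      refine ⟨l1, ?_⟩
      have n1 := l1.ne (hρ i h0).1
      have n2 := l2.ne (hρ i h0).1
      simp only [c, h0, if_false]
      field_simp
      linear_combination β (ρ i) * e
    obtain ⟨f, g, hf, hg, hfq, hfg⟩ := classScale (A := A.submatrix (Subtype.val : {x // x ∈ R} → X) id)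
      (S := (C : Set Y)) (u := u) (fun i => β (ρ i) / s (ρ i)) (by
        intro i hi
        have h1 := (hrat i i.2 hi).1
        have h2 := lift_mul (hβ (ρ i)) (lift_inv h1)
        rwa [h1.inv (hρ i hi).1] at h2) (by
        intro i j hi hj hc
        have : Cn S A i j := by
          have h := Relation.ReflTransGen.lift (r := Rel (C : Set Y) (A.submatrix (Subtype.val : {x // x ∈ R} → X) id))
            (p := Rel S A) Subtype.val (fun a b ⟨y, hy, h⟩ => ⟨y, hC hy, h⟩) _ _ hc
          exact h
        simp only [hρe _ _ this])
    have := DLon.scale1 hsR hf (g := Function.update g u 1) (by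
      intro y
      by_cases hy : y = u
      · subst hy; simpa using lift_one
      · simpa [hy] using hg y)
    refine DLon.congr this ?_
    rintro x y (rfl | hy)
    · simp only [Matrix.submatrix_apply, id, Matrix.of_apply, upd_self, Function.update_self]
      by_cases h0 : A x y = 0
      · have h1 := hsR.lift x.2
        rw [h0] at h1
        rw [(lift_zero_iff h1).2 rfl]
        simp [c, h0]
      · rw [(hrat x x.2 h0).2, hfq x h0]
        ring
    · have hyu : y ≠ u := by rintro rfl; exact hu (hC hy)
      simp only [Matrix.submatrix_apply, id, Matrix.of_apply, upd_ne _ _ _ hyu, Function.update_of_ne hyu]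
      by_cases h0 : A x y = 0
      · have h1 := hL.entry x (hC hy)
        rw [h0] at h1
        rw [(lift_zero_iff h1).2 rfl]
        simp
      · have := hfg x y hy h0
        linear_combination (- L x y) * this
  refine ⟨c, ?_⟩
  intro n r w hw
  exact key (Finset.univ.image r) ((Finset.univ.image w).filter (· ∈ S)) (by
      intro y hy; simp at hy; exact hy.2) n (fun i => ⟨r i, by simp⟩) w (by
      intro i
      rcases hw i with h | h
      · exact Or.inl h
      · exact Or.inr (by simp [h]))

theorem ex_all (hA : PM A) : ∃ L, DL A L := by
  classical
  let P : Set (Y × (X → ℚ)) → Prop := fun S => (∀ p ∈ S, ∀ q ∈ S, p.1 = q.1 → p = q) ∧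
    ∀ n (r : Fin n → X) (c : Fin n → Y × (X → ℚ)), (∀ i, c i ∈ S) →
      Lift (Matrix.of fun i j => (c j).2 (r i)).det (A.submatrix r (fun j => (c j).1)).det
  obtain ⟨M, hM⟩ := zorn_subset {S | P S} (by
    intro c hc hch
    rcases c.eq_empty_or_nonempty with rfl | hne
    · refine ⟨∅, ⟨by simp, ?_⟩, by simp⟩
      intro n r c hc
      match n, r, c, hc with
      | 0, r, c, _ => simpa using lift_one
      | n + 1, r, c, hc => exact absurd (hc 0) (by simp)
    refine ⟨⋃₀ c, ⟨?_, ?_⟩, fun s hs => Set.subset_sUnion_of_mem hs⟩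
    · rintro p ⟨s, hs, hp⟩ q ⟨t, ht, hq⟩ h
      rcases hch.total hs ht with h' | h'
      · exact (hc ht).1 p (h' hp) q hq h
      · exact (hc hs).1 p hp q (h' hq) h
    · intro n r w hw
      obtain ⟨s, hs, hsub⟩ := DirectedOn.exists_mem_subset_of_finite_of_subset_sUnion hne
        hch.directedOn (Set.finite_range w) (by rintro _ ⟨i, rfl⟩; exact hw i)
      exact (hc hs).2 n r w (fun i => hsub ⟨i, rfl⟩))
  have hP : P M := hM.prop
  let S : Set Y := Prod.fst '' M
  choose! F hF using fun (y : Y) (hy : y ∈ S) => (show ∃ f, (y, f) ∈ M by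
    obtain ⟨⟨a, b⟩, h, rfl⟩ := hy; exact ⟨b, h⟩)
  let L : Matrix X Y ℚ := Matrix.of fun x y => F y x
  have hL : DLon S A L := fun n r c hc => hP.2 n r (fun i => (c i, F (c i))) (fun i => hF _ (hc i))
  by_cases hall : ∀ y, y ∈ S
  · exact ⟨L, fun n r c => hL n r c (fun i => hall _)⟩
  push Not at hall
  exfalso
  obtain ⟨u, hu⟩ := hall
  obtain ⟨f, hf⟩ := extend hA hu hL
  have hFe : ∀ p ∈ M, p.2 = F p.1 := by
    intro p hp
    have := hP.1 p hp (p.1, F p.1) (hF _ ⟨p, hp, rfl⟩) rfl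
    rw [this]
  have hPn : P (insert (u, f) M) := by
    refine ⟨?_, ?_⟩
    · rintro p (rfl | hp) q (rfl | hq) h
      · rfl
      · exact absurd ⟨q, hq, h.symm⟩ hu
      · exact absurd ⟨p, hp, h⟩ hu
      · exact hP.1 p hp q hq h
    · intro n r c hc
      have := hf n r (fun i => (c i).1) (by
        intro i
        rcases hc i with h | h
        · exact Or.inl (by rw [h])
        · exact Or.inr ⟨_, h, rfl⟩)
      convert this using 2
      ext i j
      simp only [Matrix.of_apply, Matrix.submatrix_apply]
      rcases hc j with h | h
      · rw [h]; simp [upd]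
      · have hne : (c j).1 ≠ u := fun h' => hu ⟨_, h, h'⟩
        rw [upd_ne _ _ _ hne, hFe _ h]
        rfl
  have := hM.le_of_ge hPn (Set.subset_insert _ _)
  exact hu ⟨(u, f), this (Set.mem_insert _ _), rfl⟩

end
end Dyad

open Matrix
namespace Dyad
universe u
section
variable {X Y : Type u} {F : Type*} [Field F]

/-- Restriction of a finitely supported function to a set of coordinates. -/
def restr (F : Type*) [Field F] (P : Set X) : (X →₀ F) →ₗ[F] (P → F) where
  toFun v x := v x
  map_add' _ _ := rfl
  map_smul' _ _ := rfl

theorem ker_restr (P P' : Set X) (h : ∀ x, x ∈ P' ↔ x ∉ P) :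
    LinearMap.ker (restr F P') = Submodule.span F (Set.range (fun x : P => Finsupp.single (x : X) (1 : F))) := by
  have e : Set.range (fun x : P => Finsupp.single (x : X) (1 : F)) = (fun i => Finsupp.single i 1) '' P := by
    ext v; simp
  rw [e, ← Finsupp.supported_eq_span_single]
  ext v
  rw [LinearMap.mem_ker, Finsupp.mem_supported]
  constructor
  · intro hv x hx
    by_contra hxP
    have := congrFun hv ⟨x, (h x).2 hxP⟩
    exact (Finsupp.mem_support_iff.1 hx) this
  · intro hv
    funext x
    show v x = 0
    by_contra hx
    exact (h x).1 x.2 (hv (by simpa using hx))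

theorem LI2 (P P' : Set X) (h : ∀ x, x ∈ P' ↔ x ∉ P) (Q : Set Y) (a : Y → X →₀ F) :
    LinearIndependent F (Sum.elim (fun x : P => Finsupp.single (x : X) (1 : F)) (fun y : Q => a y)) ↔
      LinearIndependent F (fun (y : Q) (x : P') => a y x) := by
  have e : (fun (y : Q) (x : P') => a y x) = restr F P' ∘ (fun y : Q => a y) := rfl
  rw [linearIndependent_sum, e, Sum.elim_comp_inl, Sum.elim_comp_inr, ← ker_restr P P' h]
  constructor
  · rintro ⟨-, h1, h2⟩
    exact h1.map h2.symm
  · intro h1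
    refine ⟨?_, LinearIndependent.of_comp _ h1, (Submodule.range_ker_disjoint h1).symm⟩
    exact (Finsupp.linearIndependent_single_one F X).comp _ Subtype.val_injective

theorem minorLI {Q Z : Type*} {n : ℕ} (v : Q → Z → F) (s : Fin n → Z) (hs : Function.Surjective s)
    (e : Fin n → Q) (he : Function.Bijective e) :
    LinearIndependent F v ↔ (Matrix.of fun i j => v (e j) (s i)).det ≠ 0 := by
  rw [← linearIndependent_equiv (Equiv.ofBijective e he),
    ← LinearMap.linearIndependent_iff (LinearMap.funLeft F F s)
      (LinearMap.ker_eq_bot.2 (LinearMap.funLeft_injective_of_surjective F F s hs)),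
    ← isUnit_iff_ne_zero, ← Matrix.isUnit_iff_isUnit_det, ← Matrix.linearIndependent_cols_iff_isUnit]
  rfl

theorem ex_rows {Z : Type*} {n : ℕ} (v : Fin n → Z → F) (hv : LinearIndependent F v) :
    ∃ r : Fin n → Z, (Matrix.of fun i j => v j (r i)).det ≠ 0 := by
  let w : Z → (Fin n → F) := fun z j => v j z
  have hsp : Submodule.span F (Set.range w) = ⊤ := by
    by_contra hne
    obtain ⟨f, hf0, hf⟩ := Submodule.exists_le_ker_of_lt_top _ (lt_top_iff_ne_top.2 hne)
    apply hf0
    rw [Fintype.linearIndependent_iff] at hv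
    have := hv (fun j => f (Pi.single j 1)) (by
      funext z
      have hz : f (w z) = 0 := hf (Submodule.subset_span ⟨z, rfl⟩)
      rw [LinearMap.pi_apply_eq_sum_univ] at hz
      simp only [Finset.sum_apply, Pi.smul_apply, Pi.zero_apply, smul_eq_mul]
      rw [← hz]
      apply Finset.sum_congr rfl
      intro j _
      rw [smul_eq_mul, mul_comm]
      congr 2
      ext k
      simp [Pi.single_apply, eq_comm])
    apply LinearMap.pi_ext'
    intro j
    ext
    simpa using this j
  obtain ⟨κ, a, ha, hspan, hli⟩ := exists_linearIndependent' F w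
  let b := Module.Basis.mk hli (by rw [hspan, hsp])
  have : Fintype κ := FiniteDimensional.fintypeBasisIndex b
  have hcard : Fintype.card κ = n := by
    rw [← Module.finrank_eq_card_basis b]; simp
  let e : Fin n ≃ κ := (Fintype.equivFinOfCardEq hcard).symm
  refine ⟨a ∘ e, ?_⟩
  rw [← isUnit_iff_ne_zero, ← Matrix.isUnit_iff_isUnit_det, ← Matrix.linearIndependent_rows_iff_isUnit]
  exact hli.comp e e.injective

theorem LIminor {Q Z : Type*} (v : Q → Z → F) :
    LinearIndependent F v ↔ ∀ n (c : Fin n → Q), Function.Injective c →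
      ∃ r : Fin n → Z, (Matrix.of fun i j => v (c j) (r i)).det ≠ 0 := by
  constructor
  · intro h n c hc
    exact ex_rows _ (h.comp c hc)
  · intro h
    rw [linearIndependent_iff_finset_linearIndependent]
    intro s
    let e : Fin s.card ≃ s := s.equivFin.symm
    obtain ⟨r, hr⟩ := h s.card (fun i => (e i).1) (Subtype.val_injective.comp e.injective)
    rw [← isUnit_iff_ne_zero, ← Matrix.isUnit_iff_isUnit_det, ← Matrix.linearIndependent_cols_iff_isUnit] at hr
    rw [← linearIndependent_equiv e]
    exact LinearIndependent.of_comp (LinearMap.funLeft F F r) hr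

end

section
variable {α : Type u} {B E : Set α} {F : Type*} [Field F]

theorem repLI (φ : α → α → F) (a : ↥(E \ B) → (B →₀ F)) (g : (B →₀ F) →ₗ[F] (α → F))
    (hg : Function.Injective g) (h1 : ∀ x : B, φ x = g (Finsupp.single x 1))
    (h2 : ∀ y : ↥(E \ B), φ y = g (a y)) {T : Set α} (hT : T ⊆ E) (P' : Set B) (Q : Set ↥(E \ B))
    (hP : ∀ x : B, x ∈ P' ↔ x.1 ∉ T) (hQ : ∀ y : ↥(E \ B), y ∈ Q ↔ y.1 ∈ T) :
    LinearIndependent F (fun t : T => φ t) ↔ LinearIndependent F (fun (y : Q) (x : P') => a y x) := by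
  classical
  rw [← LI2 {x : B | x.1 ∈ T} P' hP Q a, ← LinearMap.linearIndependent_iff g (LinearMap.ker_eq_bot.2 hg)]
  let e : ({x : B | x.1 ∈ T} ⊕ Q) → T := Sum.elim (fun x => ⟨x.1.1, x.2⟩) (fun y => ⟨y.1.1, (hQ _).1 y.2⟩)
  have he : Function.Bijective e := by
    constructor
    · rintro (⟨⟨x, hx⟩, hx'⟩ | ⟨⟨x, hx⟩, hx'⟩) (⟨⟨y, hy⟩, hy'⟩ | ⟨⟨y, hy⟩, hy'⟩) h
      · simp only [e, Sum.elim_inl, Subtype.mk.injEq] at h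
        subst h; rfl
      · simp only [e, Sum.elim_inl, Sum.elim_inr, Subtype.mk.injEq] at h
        subst h; exact absurd hx hy.2
      · simp only [e, Sum.elim_inl, Sum.elim_inr, Subtype.mk.injEq] at h
        subst h; exact absurd hy hx.2
      · simp only [e, Sum.elim_inr, Subtype.mk.injEq] at h
        subst h; rfl
    · rintro ⟨t, ht⟩
      by_cases hB : t ∈ B
      · exact ⟨.inl ⟨⟨t, hB⟩, ht⟩, rfl⟩
      · exact ⟨.inr ⟨⟨t, hT ht, hB⟩, (hQ _).2 ht⟩, rfl⟩
  rw [← linearIndependent_equiv (Equiv.ofBijective e he)]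
  apply iff_of_eq
  congr 1
  funext w
  rcases w with x | y
  · exact h1 x.1
  · exact h2 y.1

theorem repMinor (φ : α → α → F) (a : ↥(E \ B) → (B →₀ F)) (g : (B →₀ F) →ₗ[F] (α → F))
    (hB : B ⊆ E)
    (hg : Function.Injective g) (h1 : ∀ x : B, φ x = g (Finsupp.single x 1))
    (h2 : ∀ y : ↥(E \ B), φ y = g (a y)) {n : ℕ} (r : Fin n → B) (c : Fin n → ↥(E \ B))
    (hc : Function.Injective c) :
    (Matrix.of fun i j => a (c j) (r i)).det ≠ 0 ↔
      LinearIndependent F (fun t : ↥{t | t ∈ E ∧ (∀ h : t ∈ B, ⟨t, h⟩ ∉ Set.range r) ∧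
        ∀ h : t ∈ E \ B, ⟨t, h⟩ ∈ Set.range c} => φ t) := by
  rw [repLI φ a g hg h1 h2 (fun t ht => ht.1) (Set.range r) (Set.range c)]
  · rw [minorLI _ (fun i => (⟨r i, i, rfl⟩ : Set.range r)) _ (fun i => (⟨c i, i, rfl⟩ : Set.range c))]
    · constructor
      · intro i j h; exact hc (congrArg Subtype.val h)
      · rintro ⟨_, i, rfl⟩; exact ⟨i, rfl⟩
    · rintro ⟨_, i, rfl⟩; exact ⟨i, rfl⟩
  · intro x
    constructor
    · intro hx h; exact h.2.1 x.2 hx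
    · intro h
      by_contra hx
      exact h ⟨hB x.2, fun _ => hx, fun h => absurd x.2 h.2⟩
  · intro y
    constructor
    · intro hy; exact ⟨y.2.1, fun h => absurd h y.2.2, fun _ => hy⟩
    · intro h; exact h.2.2 y.2

theorem repCoord {M : Matroid α} (hB : M.IsBase B) (φ : α → α → F)
    (hφ : ∀ X : Set α, X ⊆ M.E → (M.Indep X ↔ LinearIndependent F (fun x : X => φ (x : α)))) :
    ∃ (a : ↥(M.E \ B) → (B →₀ F)) (g : (B →₀ F) →ₗ[F] (α → F)), Function.Injective g ∧
      (∀ x : B, φ x = g (Finsupp.single x 1)) ∧ ∀ y : ↥(M.E \ B), φ y = g (a y) := by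
  have hli := (hφ B hB.subset_ground).1 hB.indep
  have hsp : ∀ y : ↥(M.E \ B), ∃ c : B →₀ F, φ y = Finsupp.linearCombination F (fun x : B => φ x) c := by
    intro y
    have : φ y ∈ Submodule.span F (Set.range (fun x : B => φ x)) := by
      by_contra hy
      have h : LinearIndepOn F φ (insert y.1 B) := by
        rw [linearIndepOn_insert y.2.2]
        refine ⟨hli, ?_⟩
        have e : φ '' B = Set.range (fun x : B => φ x) := by ext; simp
        rw [e]
        exact hy
      have h2 := (hφ _ (Set.insert_subset y.2.1 hB.subset_ground)).2 h
      exact (hB.insert_dep y.2).not_indep h2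
    obtain ⟨c, hc⟩ := (Finsupp.mem_span_range_iff_exists_finsupp).1 this
    exact ⟨c, hc.symm⟩
  choose a ha using hsp
  exact ⟨a, _, hli, fun x => by simp, ha⟩

theorem main {α : Type u} (M : Matroid α) (h3 : M.Representable' (ZMod 3))
    (h5 : M.Representable' (ZMod 5)) : M.Representable' ℚ := by
  classical
  obtain ⟨B, hB⟩ := M.exists_isBase
  obtain ⟨φ3, hφ3⟩ := h3
  obtain ⟨φ5, hφ5⟩ := h5
  obtain ⟨a3, g3, i3, b3, c3⟩ := repCoord hB φ3 hφ3
  obtain ⟨a5, g5, i5, b5, c5⟩ := repCoord hB φ5 hφ5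
  let A : Matrix B ↥(M.E \ B) K := Matrix.of fun x y => (a3 y x, a5 y x)
  have d1 : ∀ n (r : Fin n → B) (c : Fin n → ↥(M.E \ B)),
      (A.submatrix r c).det.1 = (Matrix.of fun i j => a3 (c j) (r i)).det := by
    intro n r c
    exact RingHom.map_det (RingHom.fst (ZMod 3) (ZMod 5)) _
  have d2 : ∀ n (r : Fin n → B) (c : Fin n → ↥(M.E \ B)),
      (A.submatrix r c).det.2 = (Matrix.of fun i j => a5 (c j) (r i)).det := by
    intro n r c
    exact RingHom.map_det (RingHom.snd (ZMod 3) (ZMod 5)) _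
  have hA : PM A := by
    intro n r c
    unfold U
    by_cases hc : Function.Injective c
    · rw [d1, d2, ← not_iff_not]
      have e3 := repMinor φ3 a3 g3 hB.subset_ground i3 b3 c3 r c hc
      have e5 := repMinor φ5 a5 g5 hB.subset_ground i5 b5 c5 r c hc
      exact e3.trans (((hφ3 _ (fun t ht => ht.1)).symm.trans (hφ5 _ (fun t ht => ht.1))).trans e5.symm)
    · obtain ⟨i, j, hij, hne⟩ : ∃ i j, c i = c j ∧ i ≠ j := by
        simpa [Function.Injective] using hc
      rw [Matrix.det_zero_of_column_eq hne (by intro k; simp only [Matrix.submatrix_apply, hij])]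
      simp
  obtain ⟨L, hL⟩ := ex_all hA
  have hdet : ∀ n (r : Fin n → B) (c : Fin n → ↥(M.E \ B)),
      (L.submatrix r c).det = 0 ↔ (Matrix.of fun i j => a3 (c j) (r i)).det = 0 := by
    intro n r c
    rw [lift_zero_iff (hL n r c), ← d1]
    have := hA n r c
    constructor
    · intro h; rw [h]; rfl
    · intro h; exact Prod.ext h (this.1 h)
  have hsup : ∀ y x, L x y ≠ 0 → x ∈ (a3 y).support := by
    intro y x hx
    have := hdet 1 (fun _ => x) (fun _ => y)
    simp only [Matrix.det_fin_one, Matrix.submatrix_apply, Matrix.of_apply] at this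
    rw [Finsupp.mem_support_iff]
    exact fun h => hx (this.2 h)
  let a : ↥(M.E \ B) → (B →₀ ℚ) := fun y => Finsupp.onFinset (a3 y).support (fun x => L x y) (hsup y)
  let g : (B →₀ ℚ) →ₗ[ℚ] (α → ℚ) :=
    (Finsupp.lcoeFun : (α →₀ ℚ) →ₗ[ℚ] (α → ℚ)) ∘ₗ Finsupp.lmapDomain ℚ ℚ (Subtype.val : B → α)
  have hg : Function.Injective g := by
    intro v w h
    exact Finsupp.mapDomain_injective Subtype.val_injective (DFunLike.coe_injective h)
  let φ : α → α → ℚ := fun e => if h : e ∈ B then g (Finsupp.single ⟨e, h⟩ 1) else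
    if h : e ∈ M.E \ B then g (a ⟨e, h⟩) else 0
  refine ⟨φ, fun T hT => ?_⟩
  let P' : Set B := {x | x.1 ∉ T}
  let Q : Set ↥(M.E \ B) := {y | y.1 ∈ T}
  rw [hφ3 T hT, repLI φ3 a3 g3 i3 b3 c3 hT P' Q (fun _ => Iff.rfl) (fun _ => Iff.rfl),
    repLI φ a g hg (fun x => by simp only [φ]; rw [dif_pos x.2])
      (fun y => by simp only [φ]; rw [dif_neg y.2.2, dif_pos y.2]) hT P' Q (fun _ => Iff.rfl) (fun _ => Iff.rfl),
    LIminor, LIminor]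
  refine forall_congr' fun n => forall_congr' fun c => forall_congr' fun hc => exists_congr fun r => ?_
  exact (not_congr (hdet n (fun i => (r i).1) (fun j => (c j).1))).symm

end
end Dyad

/-- a matroid representable over GF(3) and over GF(5) is
representable over the rationals. -/
theorem representable_rat_of_gf3_gf5 {α : Type*} (M : Matroid α)
    (h3 : M.Representable' (ZMod 3)) (h5 : M.Representable' (ZMod 5)) :
    M.Representable' ℚ := by
  exact Dyad.main M h3 h5
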